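/- arXiv:2409.00775 — 4 statements merged into one kernel-verified Lean document; each statement's English description precedes it below -/
import Mathlib

section
/- For every real number d with 0 ≤ d ≤ 1, there exists a sequence (r_n)_{n≥1} of positive integers with r_n → ∞ such that the Hausdorff dimension of E(r) equals d. -/
open Filter Set

/-- `Eset r` is the set of reals `x` such that the sequence `(r_n x)` is *not*
dense modulo 1, i.e. the set of fractional parts `{r_n x}` is not dense in `[0,1)`. -/
def Eset (r : ℕ → ℕ) : Set ℝ :=
  {x | ¬ Set.Ico (0 : ℝ) 1 ⊆ closure (Set.range fun n : ℕ => Int.fract ((r n : ℝ) * x))}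

lemma dimH_le_dimH_image_div {H : ℝ → ℝ} {S : Set ℝ} {C s : NNReal} (hs : 0 < s)
    (h : ∀ t ∈ S, ∀ u ∈ S, edist t u ≤ C * edist (H t) (H u) ^ (s : ℝ)) :
    dimH S ≤ dimH (H '' S) / s := by
  have hinj : InjOn H S := by
    intro t ht u hu htu
    have := h t ht u hu
    rw [htu, edist_self, ENNReal.zero_rpow_of_pos (by exact_mod_cast hs), mul_zero] at this
    exact edist_le_zero.mp this
  have himg : Function.invFunOn H S '' (H '' S) = S := hinj.invFunOn_image subset_rfl
  have hol : HolderOnWith C s (Function.invFunOn H S) (H '' S) := by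
    rintro _ ⟨t, ht, rfl⟩ _ ⟨u, hu, rfl⟩
    rw [hinj.leftInvOn_invFunOn ht, hinj.leftInvOn_invFunOn hu]
    exact h t ht u hu
  simpa only [himg] using hol.dimH_image_le hs

/-- If the first `M` multiples of `y` avoid an interval modulo one, then `y` is close to a rational
whose denominator is bounded in terms of the length of the interval only. -/
lemma exists_abs_factorial_mul_sub_le {a b y : ℝ} {M N : ℕ} (ha : 0 ≤ a) (hb : b ≤ 1)
    (hN : 0 < N) (hNab : 1 / ((N : ℝ) + 1) < b - a) (hM : 0 < M)
    (h : ∀ m : ℕ, 1 ≤ m → m ≤ M → ∀ z : ℤ, (m : ℝ) * y - z ∉ Ioo a b) :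
    ∃ z : ℤ, |(N.factorial : ℝ) * y - z| ≤ 2 * N.factorial / M := by
  obtain ⟨p, hp0, hpN, hp⟩ := Real.exists_nat_abs_mul_sub_round_le y hN
  have hMR : (0 : ℝ) < M := by exact_mod_cast hM
  have hpR : (0 : ℝ) < p := by exact_mod_cast hp0
  have key : ∀ (a b w δ : ℝ) (z : ℤ), 0 ≤ a → a ≤ 1 → δ < b - a → δ ≤ 1 →
      (∀ m : ℕ, 1 ≤ m → m ≤ M → ∀ z : ℤ, (m : ℝ) * w - z ∉ Ioo a b) →
      δ = p * w - z → δ ≤ 2 * p / M := by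
    intro a b w δ z ha ha1 hδ hδ1 h hδz
    by_contra! hlt
    have hδ0 : 0 < δ := lt_of_le_of_lt (by positivity) hlt
    set j : ℕ := ⌊a / δ⌋₊ + 1 with hj
    have hj1 : a < j * δ := by
      rw [← div_lt_iff₀ hδ0, hj]
      push_cast
      exact Nat.lt_floor_add_one _
    have hfl : ((j : ℝ) - 1) * δ ≤ a := by
      rw [← le_div_iff₀ hδ0, hj]
      push_cast
      simpa using Nat.floor_le (div_nonneg ha hδ0.le)
    have hjM : j * p ≤ M := by
      have h1 : (j : ℝ) * δ ≤ 2 := by nlinarith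
      rw [div_lt_iff₀ hMR] at hlt
      have h2 : ((j * p : ℕ) : ℝ) * δ ≤ M * δ := by
        push_cast
        nlinarith
      exact_mod_cast le_of_mul_le_mul_right h2 hδ0
    refine h (j * p) (Nat.mul_pos (Nat.succ_pos _) hp0) hjM (j * z) ?_
    have : ((j * p : ℕ) : ℝ) * w - ((j * z : ℤ) : ℝ) = j * δ := by
      rw [hδz]; push_cast; ring
    rw [this]
    exact ⟨hj1, by nlinarith⟩
  have hab : a < b := by
    have : (0 : ℝ) < 1 / ((N : ℝ) + 1) := by positivity
    linarith
  have hδ : |(p : ℝ) * y - round ((p : ℝ) * y)| ≤ 2 * p / M := by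
    obtain ⟨h1, h2⟩ := abs_le.mp hp
    rw [abs_le]
    constructor
    · have := key (1 - b) (1 - a) (-y) (p * (-y) - (-round ((p : ℝ) * y) : ℤ))
        (-round ((p : ℝ) * y)) (by linarith) (by linarith) (by push_cast; linarith)
        (by push_cast; linarith) (fun m hm hmM z hz => h m hm hmM (-z - 1) (by
          push_cast
          exact ⟨by linarith [hz.2], by linarith [hz.1]⟩)) rfl
      push_cast at this
      linarith
    · exact key a b y _ _ ha (by linarith) (by linarith) (by linarith) h rfl
  obtain ⟨c, hc⟩ := Nat.dvd_factorial hp0 hpN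
  refine ⟨c * round ((p : ℝ) * y), ?_⟩
  have hcc : (N.factorial : ℝ) * y - ((c * round ((p : ℝ) * y) : ℤ) : ℝ) =
      c * ((p : ℝ) * y - round ((p : ℝ) * y)) := by
    rw [hc]; push_cast; ring
  rw [hcc, abs_mul, Nat.abs_cast, hc]
  calc (c : ℝ) * |(p : ℝ) * y - round ((p : ℝ) * y)| ≤ c * (2 * p / M) := by gcongr
    _ = _ := by push_cast; ring

/-- Positive multiples `m * q k` with `m ≤ M k`. -/
def multiplesUpTo (q M : ℕ → ℕ) : Set ℕ :=
  {n | ∃ k m, 1 ≤ m ∧ m ≤ M k ∧ n = m * q k}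

/-- The points `x` all of whose multiples `N! * q k * x` are within `2 * N! / M k` of an integer. -/
def nearRational (q M : ℕ → ℕ) (N : ℕ) : Set ℝ :=
  {x | |x| ≤ N.factorial ∧
    ∀ k, ∃ z : ℤ, |(N.factorial : ℝ) * (q k * x) - z| ≤ 2 * N.factorial / M k}

lemma Eset_subset_iUnion_nearRational {q M r : ℕ → ℕ} (hM : ∀ k, 0 < M k)
    (hr : range r = multiplesUpTo q M) : Eset r ⊆ ⋃ N, nearRational q M N := by
  intro x hx
  obtain ⟨y, hy, hyc⟩ := not_subset.mp hx
  rw [Metric.mem_closure_iff] at hyc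
  push Not at hyc
  obtain ⟨ε, hε, hyε⟩ := hyc
  have hlen : 0 < min (y + ε) 1 - y := by
    have := lt_min (show y < y + ε by linarith) hy.2
    linarith
  obtain ⟨N₁, hN₁⟩ := exists_nat_one_div_lt hlen
  obtain ⟨N₂, hN₂⟩ := exists_nat_ge |x|
  set N := max (max N₁ N₂) 1
  have h1 : N₁ ≤ N := (le_max_left _ _).trans (le_max_left _ _)
  have h2 : N₂ ≤ N := (le_max_right _ _).trans (le_max_left _ _)
  refine mem_iUnion.mpr ⟨N, hN₂.trans ?_, fun k => ?_⟩
  · exact_mod_cast h2.trans N.self_le_factorial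
  · refine exists_abs_factorial_mul_sub_le (a := y) (b := min (y + ε) 1) hy.1 (min_le_right _ _)
      (lt_of_lt_of_le one_pos (le_max_right _ _)) (lt_of_le_of_lt ?_ hN₁) (hM k) ?_
    · gcongr
    · intro m hm hmM z hz
      obtain ⟨n, hn⟩ : m * q k ∈ range r := hr ▸ ⟨k, m, hm, hmM, rfl⟩
      have hfr : Int.fract ((r n : ℝ) * x) = m * (q k * x) - z := by
        rw [Int.fract_eq_iff]
        refine ⟨hy.1.trans hz.1.le, hz.2.trans_le (min_le_right _ _), z, ?_⟩
        rw [hn]; push_cast; ring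
      have := hyε _ ⟨n, rfl⟩
      simp only [hfr] at this
      rw [Real.dist_eq, abs_sub_comm, abs_of_pos (by linarith [hz.1])] at this
      have := hz.2.trans_le (min_le_left _ _)
      linarith

lemma subset_Eset {q M B r : ℕ → ℕ} (hB : ∀ k, B k = 2 * M k)
    (hr : range r = multiplesUpTo q M) :
    {x : ℝ | ∀ k, ∃ z : ℤ, (q k : ℝ) * x - z ∈ Icc (0 : ℝ) (1 / B k)} ⊆ Eset r := by
  intro x hx hsub
  have hcl : closure (range fun n : ℕ => Int.fract ((r n : ℝ) * x)) ⊆ Icc 0 (1 / 2) := by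
    refine closure_minimal ?_ isClosed_Icc
    rintro _ ⟨n, rfl⟩
    obtain ⟨k, m, hm, hmM, hn⟩ : r n ∈ multiplesUpTo q M := hr ▸ mem_range_self n
    obtain ⟨z, hz0, hz1⟩ := hx k
    have hM : (0 : ℝ) < M k := by exact_mod_cast lt_of_lt_of_le hm hmM
    have hmM' : (m : ℝ) ≤ M k := by exact_mod_cast hmM
    have h0 : 0 ≤ (m : ℝ) * (q k * x - z) := by positivity
    have h1 : (m : ℝ) * (q k * x - z) ≤ 1 / 2 := by
      calc (m : ℝ) * (q k * x - z) ≤ M k * (1 / B k) := by gcongr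
        _ = 1 / 2 := by rw [hB]; push_cast; field_simp
    have hfr : Int.fract ((r n : ℝ) * x) = m * (q k * x - z) := by
      rw [Int.fract_eq_iff]
      refine ⟨h0, by linarith, m * z, ?_⟩
      rw [hn]; push_cast; ring
    simp only [hfr]
    exact ⟨h0, h1⟩
  have := hcl (hsub (show (3 / 4 : ℝ) ∈ Ico 0 1 by norm_num))
  norm_num at this

open MeasureTheory in
lemma dimH_nearRational_le {q M : ℕ → ℕ} {d : ℝ} (hd : 0 < d) (hq : Tendsto q atTop atTop)
    (hq0 : ∀ k, 0 < q k) (hM : ∀ k, (q k : ℝ) ^ d⁻¹ ≤ q k * M k) (N : ℕ) :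
    dimH (nearRational q M N) ≤ ENNReal.ofReal d := by
  have hMpos : ∀ k, (0 : ℝ) < M k := fun k => by
    have hqk : (0 : ℝ) < q k := by exact_mod_cast hq0 k
    exact pos_of_mul_pos_right ((Real.rpow_pos_of_pos hqk _).trans_le (hM k)) hqk.le
  set L : ℕ := N.factorial with hL
  have hL1 : (1 : ℝ) ≤ L := by exact_mod_cast N.factorial_pos
  let n : ℕ → ℤ := fun k => 3 * L ^ 2 * q k
  let ρ : ℕ → ℝ := fun k => 2 * (q k : ℝ) ^ (-d⁻¹)
  let t : ∀ k, Finset.Icc (-n k) (n k) → Set ℝ := fun k z => Metric.closedBall (z / (L * q k)) (ρ k)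
  have hρ : Tendsto (fun k => ENNReal.ofReal (2 * ρ k)) atTop (nhds 0) := by
    rw [← ENNReal.ofReal_zero]
    refine ENNReal.tendsto_ofReal ?_
    have := (tendsto_rpow_neg_atTop (inv_pos.mpr hd)).comp
      (tendsto_natCast_atTop_atTop (R := ℝ) |>.comp hq)
    simpa [ρ, Function.comp_def, ← mul_assoc] using this.const_mul (2 * 2)
  have hdiam : ∀ k z, Metric.ediam (t k z) ≤ ENNReal.ofReal (2 * ρ k) := by
    intro k z
    simp only [t, Real.closedBall_eq_Icc, Real.ediam_Icc]
    exact ENNReal.ofReal_le_ofReal (by linarith)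
  have hcover : ∀ k, nearRational q M N ⊆ ⋃ z, t k z := by
    rintro k x ⟨hxL, hx⟩
    obtain ⟨z, hz⟩ := hx k
    rw [← hL] at hz hxL
    have hqk : (1 : ℝ) ≤ q k := by exact_mod_cast hq0 k
    have hM1 : (1 : ℝ) ≤ M k := by
      have := hMpos k
      exact_mod_cast this
    have hzn : |(z : ℝ)| ≤ 3 * L ^ 2 * q k := by
      have h1 : |(L : ℝ) * (q k * x)| ≤ L * (q k * L) := by
        rw [abs_mul, abs_mul, Nat.abs_cast, Nat.abs_cast]
        gcongr
      have h2 : (2 * L / M k : ℝ) ≤ 2 * L * (L * q k) := by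
        calc (2 * L / M k : ℝ) ≤ 2 * L := div_le_self (by positivity) hM1
          _ ≤ 2 * L * (L * q k) := by
            refine le_mul_of_one_le_right (by positivity) ?_
            nlinarith
      have h3 : |(z : ℝ)| ≤ |(L : ℝ) * (q k * x)| + |(L : ℝ) * (q k * x) - z| := by
        have := abs_sub ((L : ℝ) * (q k * x)) ((L : ℝ) * (q k * x) - z)
        simpa using this
      nlinarith
    have hzmem : z ∈ Finset.Icc (-n k) (n k) := by
      rw [Finset.mem_Icc, ← abs_le]
      have : ((|z| : ℤ) : ℝ) ≤ ((n k : ℤ) : ℝ) := by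
        simp only [n]; push_cast; exact hzn
      exact_mod_cast this
    refine mem_iUnion.mpr ⟨⟨z, hzmem⟩, ?_⟩
    have hLq : (0 : ℝ) < L * q k := by positivity
    rw [Metric.mem_closedBall, Real.dist_eq]
    have : x - z / (L * q k) = (L * (q k * x) - z) / (L * q k) := by field_simp
    rw [this, abs_div, abs_of_pos hLq, div_le_iff₀ hLq]
    refine hz.trans ?_
    have hqd : (0 : ℝ) < (q k : ℝ) ^ d⁻¹ := by positivity
    have := hM k
    simp only [ρ, Real.rpow_neg (by positivity : (0 : ℝ) ≤ q k)]
    rw [div_le_iff₀ (hMpos k)]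
    calc (2 * L : ℝ) = 2 * ((q k : ℝ) ^ d⁻¹)⁻¹ * L * (q k : ℝ) ^ d⁻¹ := by field_simp
      _ ≤ 2 * ((q k : ℝ) ^ d⁻¹)⁻¹ * L * (q k * M k) := by gcongr
      _ = _ := by ring
  have hsum : ∀ k, ∑ z, Metric.ediam (t k z) ^ d ≤ ENNReal.ofReal (7 * L ^ 2 * 4 ^ d) := by
    intro k
    have hqk : (1 : ℝ) ≤ q k := by exact_mod_cast hq0 k
    have hcard : (Fintype.card (Finset.Icc (-n k) (n k)) : ℝ) ≤ 7 * L ^ 2 * q k := by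
      have h0 : (0 : ℤ) ≤ n k := by positivity
      have h1 : ((n k + 1 - -n k).toNat : ℤ) = 2 * n k + 1 := by omega
      have h2 : ((n k + 1 - -n k).toNat : ℝ) = 2 * (3 * L ^ 2 * q k) + 1 := by
        have := congrArg (Int.cast : ℤ → ℝ) h1
        simp only [n] at this ⊢
        push_cast at this ⊢
        exact this
      rw [Fintype.card_coe, Int.card_Icc, h2]
      nlinarith [one_le_mul_of_one_le_of_one_le (one_le_pow₀ hL1 (n := 2)) hqk]
    have hpow : (2 * ρ k) ^ d = 4 ^ d * (q k : ℝ)⁻¹ := by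
      have : 2 * ρ k = 4 * (q k : ℝ) ^ (-d⁻¹) := by simp only [ρ]; ring
      rw [this, Real.mul_rpow (by norm_num) (by positivity), ← Real.rpow_mul (by positivity),
        neg_mul, inv_mul_cancel₀ hd.ne', Real.rpow_neg_one]
    calc ∑ z, Metric.ediam (t k z) ^ d
        ≤ ∑ _z : Finset.Icc (-n k) (n k), ENNReal.ofReal (2 * ρ k) ^ d :=
          Finset.sum_le_sum fun z _ => ENNReal.rpow_le_rpow (hdiam k z) hd.le
      _ = ENNReal.ofReal (Fintype.card (Finset.Icc (-n k) (n k)) * (2 * ρ k) ^ d) := by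
          rw [Finset.sum_const, Finset.card_univ, nsmul_eq_mul,
            ENNReal.ofReal_rpow_of_nonneg (by positivity) hd.le,
            ENNReal.ofReal_mul (by positivity), ENNReal.ofReal_natCast]
      _ ≤ ENNReal.ofReal (7 * L ^ 2 * 4 ^ d) := by
          refine ENNReal.ofReal_le_ofReal ?_
          rw [hpow]
          calc _ ≤ 7 * L ^ 2 * q k * (4 ^ d * (q k : ℝ)⁻¹) := by gcongr
            _ = _ := by field_simp
  have hμ : μH[(d.toNNReal : ℝ)] (nearRational q M N) ≠ ⊤ := by
    rw [Real.coe_toNNReal _ hd.le]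
    refine ne_top_of_le_ne_top (ENNReal.ofReal_ne_top (r := 7 * L ^ 2 * 4 ^ d))
      ((Measure.hausdorffMeasure_le_liminf_sum d _ _ hρ t (.of_forall hdiam)
        (.of_forall hcover)).trans ?_)
    exact liminf_le_of_le (by isBoundedDefault) fun b hb =>
      let ⟨k, hk⟩ := hb.exists
      hk.trans (hsum k)
  exact dimH_le_of_hausdorffMeasure_ne_top hμ

/-- Partial sums of the map transferring the mixed radix digits of `t` with respect to the bases
`A k` to the denominators `q (k + 1)`; here `P k` is the product of the first `k` bases. -/
noncomputable def digitSum (q P A : ℕ → ℕ) (t : ℝ) (k : ℕ) : ℝ :=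
  ∑ i ∈ Finset.range k, ((⌊P (i + 1) * t⌋ - A i * ⌊P i * t⌋ : ℤ) : ℝ) / q (i + 1)

section DigitSum

variable {q P A B : ℕ → ℕ}

lemma floor_mul_sub_nonneg_and_lt {a : ℕ} (ha : 0 < a) (x : ℝ) :
    0 ≤ ⌊a * x⌋ - a * ⌊x⌋ ∧ ⌊a * x⌋ - a * ⌊x⌋ + 1 ≤ (a : ℤ) := by
  have haR : (0 : ℝ) < a := by exact_mod_cast ha
  constructor
  · have : (a : ℤ) * ⌊x⌋ ≤ ⌊a * x⌋ := by
      rw [Int.le_floor]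
      push_cast
      exact mul_le_mul_of_nonneg_left (Int.floor_le x) haR.le
    linarith
  · have : ⌊a * x⌋ < (a : ℤ) * ⌊x⌋ + a := by
      rw [Int.floor_lt]
      push_cast
      nlinarith [Int.lt_floor_add_one x]
    linarith

lemma digit_mem (hA : ∀ k, 0 < A k) (hPs : ∀ k, P (k + 1) = P k * A k) (t : ℝ) (k : ℕ) :
    0 ≤ ⌊P (k + 1) * t⌋ - A k * ⌊P k * t⌋ ∧ ⌊P (k + 1) * t⌋ - A k * ⌊P k * t⌋ + 1 ≤ (A k : ℤ) := by
  have h : (P (k + 1) : ℝ) * t = A k * (P k * t) := by rw [hPs]; push_cast; ring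
  rw [h]
  exact floor_mul_sub_nonneg_and_lt (hA k) _

lemma digitSum_monotone (hA : ∀ k, 0 < A k) (hPs : ∀ k, P (k + 1) = P k * A k) (t : ℝ) :
    Monotone (digitSum q P A t) := by
  refine monotone_nat_of_le_succ fun k => ?_
  simp only [digitSum, Finset.sum_range_succ]
  have : (0 : ℝ) ≤ ((⌊P (k + 1) * t⌋ - A k * ⌊P k * t⌋ : ℤ) : ℝ) := by
    exact_mod_cast (digit_mem hA hPs t k).1
  have := div_nonneg this (Nat.cast_nonneg (q (k + 1)))
  linarith

lemma digitSum_add_antitone (hA : ∀ k, 0 < A k) (hPs : ∀ k, P (k + 1) = P k * A k)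
    (hq0 : ∀ k, 0 < q k) (hB : ∀ k, 0 < B k) (hqs : ∀ k, q (k + 1) = q k * B k * A k) (t : ℝ) :
    Antitone fun k => digitSum q P A t k + 1 / (q k * B k) := by
  refine antitone_nat_of_succ_le fun k => ?_
  simp only [digitSum, Finset.sum_range_succ]
  have h1 : ((⌊P (k + 1) * t⌋ - A k * ⌊P k * t⌋ : ℤ) : ℝ) + 1 ≤ A k := by
    exact_mod_cast (digit_mem hA hPs t k).2
  have hq' : (0 : ℝ) < q (k + 1) := by exact_mod_cast hq0 _
  have hqk : (0 : ℝ) < q k := by exact_mod_cast hq0 _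
  have hBk : (0 : ℝ) < B k := by exact_mod_cast hB _
  have hAk : (0 : ℝ) < A k := by exact_mod_cast hA _
  have hB1 : (1 : ℝ) ≤ B (k + 1) := by exact_mod_cast hB _
  have h2 : 1 / ((q (k + 1) : ℝ) * B (k + 1)) ≤ 1 / q (k + 1) :=
    one_div_le_one_div_of_le hq' (le_mul_of_one_le_right hq'.le hB1)
  have h3 : (A k : ℝ) / q (k + 1) = 1 / (q k * B k) := by
    rw [hqs]; push_cast; field_simp
  have h4 := div_le_div_of_nonneg_right h1 hq'.le
  rw [add_div, h3] at h4
  linarith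

lemma exists_int_mul_digitSum_eq (hqs : ∀ k, q (k + 1) = q k * B k * A k) (hq0 : ∀ k, 0 < q k)
    (t : ℝ) (k : ℕ) : ∃ z : ℤ, (q k : ℝ) * digitSum q P A t k = z := by
  induction k with
  | zero => exact ⟨0, by simp [digitSum]⟩
  | succ k ih =>
    obtain ⟨z, hz⟩ := ih
    have hq' : (q (k + 1) : ℝ) ≠ 0 := by exact_mod_cast (hq0 _).ne'
    refine ⟨B k * A k * z + (⌊P (k + 1) * t⌋ - A k * ⌊P k * t⌋), ?_⟩
    have : digitSum q P A t (k + 1) =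
        digitSum q P A t k + ((⌊P (k + 1) * t⌋ - A k * ⌊P k * t⌋ : ℤ) : ℝ) / q (k + 1) := by
      simp only [digitSum, Finset.sum_range_succ]
    rw [this, mul_add, mul_div_cancel₀ _ hq']
    have : (q (k + 1) : ℝ) * digitSum q P A t k = B k * A k * z := by
      rw [← hz, hqs]; push_cast; ring
    rw [this]; push_cast; ring

lemma digitSum_eq_of_floor_eq {t u : ℝ} {k : ℕ}
    (h : ∀ j ≤ k, ⌊P j * t⌋ = ⌊P j * u⌋) : digitSum q P A t k = digitSum q P A u k := by
  refine Finset.sum_congr rfl fun i hi => ?_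
  have := Finset.mem_range.mp hi
  rw [h i (by omega), h (i + 1) (by omega)]

lemma exists_floor_ne {t u : ℝ} (hP : Tendsto P atTop atTop) (htu : t < u) :
    ∃ k, ⌊P k * t⌋ ≠ ⌊P k * u⌋ := by
  obtain ⟨k, hk⟩ := ((tendsto_natCast_atTop_atTop (R := ℝ)).comp hP).eventually_ge_atTop
    (1 / (u - t)) |>.exists
  refine ⟨k, fun h => ?_⟩
  rw [Function.comp_apply, div_le_iff₀ (by linarith)] at hk
  have h1 := Int.floor_le ((P k : ℝ) * t)
  have h2 := Int.lt_floor_add_one ((P k : ℝ) * u)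
  rw [← h] at h2
  linarith

/-- The Hölder bound for the inverse of the digit transfer map. -/
lemma sub_le_mul_rpow_digitSum {s C t u x y : ℝ} (hA : ∀ k, 0 < A k)
    (hPs : ∀ k, P (k + 1) = P k * A k) (hP0 : P 0 = 1) (hP : Tendsto P atTop atTop)
    (hq0 : ∀ k, 0 < q k) (hB : ∀ k, 2 ≤ B k) (hqs : ∀ k, q (k + 1) = q k * B k * A k)
    (hs : 0 < s) (hs1 : s ≤ 1) (hC : ∀ k, ((q k : ℝ) * B k) ^ s ≤ C * P k)
    (ht : t ∈ Ico (0 : ℝ) 1) (hu : u ∈ Ico (0 : ℝ) 1) (htu : t < u)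
    (hx : ∀ k, x ≤ digitSum q P A t k + 1 / (q k * B k)) (hy : ∀ k, digitSum q P A u k ≤ y) :
    0 < y - x ∧ u - t ≤ 4 * C * (y - x) ^ s := by
  classical
  have hex := exists_floor_ne hP htu
  obtain ⟨k, hk⟩ : ∃ k, Nat.find hex = k + 1 := by
    refine Nat.exists_eq_succ_of_ne_zero fun h0 => ?_
    have := Nat.find_spec hex
    rw [h0, hP0] at this
    simp [Int.floor_eq_zero_iff.mpr ht, Int.floor_eq_zero_iff.mpr hu] at this
  have hne : ⌊P (k + 1) * t⌋ ≠ ⌊P (k + 1) * u⌋ := hk ▸ Nat.find_spec hex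
  have heq : ∀ j ≤ k, ⌊P j * t⌋ = ⌊P j * u⌋ := fun j hj => by
    simpa using Nat.find_min hex (m := j) (by omega)
  have hlt : ⌊P (k + 1) * t⌋ < ⌊P (k + 1) * u⌋ :=
    lt_of_le_of_ne (Int.floor_mono (by gcongr)) hne
  obtain ⟨Δ, hΔ⟩ : ∃ Δ : ℤ, Δ = ⌊P (k + 1) * u⌋ - ⌊P (k + 1) * t⌋ := ⟨_, rfl⟩
  have hqk : (0 : ℝ) < q k := by exact_mod_cast hq0 _
  have hq' : (0 : ℝ) < q (k + 1) := by exact_mod_cast hq0 _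
  have hBk : (0 : ℝ) < B k := by exact_mod_cast lt_of_lt_of_le two_pos (hB _)
  have hB2 : (2 : ℝ) ≤ B (k + 1) := by exact_mod_cast hB _
  have hAk : (0 : ℝ) < A k := by exact_mod_cast hA _
  have hΔ1 : (1 : ℝ) ≤ Δ := by
    have : 1 ≤ Δ := by omega
    exact_mod_cast this
  have hΔA : (Δ : ℝ) ≤ A k := by
    have h1 := (digit_mem hA hPs t k).1
    have h2 := (digit_mem hA hPs u k).2
    rw [heq k le_rfl] at h1
    have : Δ ≤ A k := by linarith
    exact_mod_cast this
  have hPpos : ∀ j, 0 < P j := fun j => by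
    induction j with
    | zero => simp [hP0]
    | succ j ih => rw [hPs]; exact Nat.mul_pos ih (hA j)
  have hPk : (0 : ℝ) < P k := by exact_mod_cast hPpos k
  have hPk' : (P (k + 1) : ℝ) = P k * A k := by rw [hPs]; push_cast; ring
  have hqk' : (q (k + 1) : ℝ) = q k * B k * A k := by rw [hqs]; push_cast; ring
  have hdiff : (Δ : ℝ) / (2 * q (k + 1)) ≤ y - x := by
    have h1 : digitSum q P A u (k + 1) - digitSum q P A t (k + 1) = Δ / q (k + 1) := by
      have := digitSum_eq_of_floor_eq (q := q) (A := A) heq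
      simp only [digitSum, Finset.sum_range_succ] at this ⊢
      rw [this, add_sub_add_left_eq_sub, ← sub_div, hΔ, heq k le_rfl]
      push_cast; ring
    have h2 : 1 / ((q (k + 1) : ℝ) * B (k + 1)) ≤ 1 / (2 * q (k + 1)) :=
      one_div_le_one_div_of_le (by positivity) (by nlinarith)
    have h3 : (Δ : ℝ) / q (k + 1) = Δ / (2 * q (k + 1)) + Δ / (2 * q (k + 1)) := by
      field_simp; ring
    have h4 : 1 / (2 * q (k + 1) : ℝ) ≤ Δ / (2 * q (k + 1)) := by gcongr
    linarith [hx (k + 1), hy (k + 1)]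
  have hyx : 0 < y - x := lt_of_lt_of_le (by positivity) hdiff
  refine ⟨hyx, ?_⟩
  have hC0 : 0 < C := by
    have h1 : 0 < ((q k : ℝ) * B k) ^ s := by positivity
    exact pos_of_mul_pos_left (h1.trans_le (hC k)) hPk.le
  have hD : u - t ≤ 2 * Δ / P (k + 1) := by
    rw [le_div_iff₀ (by rw [hPk']; positivity)]
    have h1 := Int.floor_le ((P (k + 1) : ℝ) * t)
    have h2 := Int.lt_floor_add_one ((P (k + 1) : ℝ) * u)
    have h3 : (Δ : ℝ) = ⌊P (k + 1) * u⌋ - ⌊P (k + 1) * t⌋ := by rw [hΔ]; push_cast; ring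
    linarith
  have hfrac : (Δ : ℝ) / A k ≤ ((Δ : ℝ) / A k) ^ s :=
    Real.self_le_rpow_of_le_one (by positivity) ((div_le_one hAk).mpr hΔA) hs1
  have hw : 0 < ((q k : ℝ) * B k) ^ s := by positivity
  have hPC : 1 / (P k : ℝ) ≤ C / ((q k : ℝ) * B k) ^ s := by
    rw [div_le_div_iff₀ hPk hw, one_mul]
    exact hC k
  calc u - t ≤ 2 * Δ / P (k + 1) := hD
    _ = 2 * (Δ / A k) * (1 / P k) := by rw [hPk']; field_simp
    _ ≤ 2 * (Δ / A k) ^ s * (C / ((q k : ℝ) * B k) ^ s) := by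
        gcongr ?_ * ?_
        exact mul_le_mul_of_nonneg_left hfrac zero_le_two
    _ = 2 * C * (2 * (Δ / (2 * q (k + 1)))) ^ s := by
        have : 2 * ((Δ : ℝ) / (2 * q (k + 1))) = (Δ / A k) / (q k * B k) := by
          rw [hqk']; field_simp
        rw [this, Real.div_rpow (x := Δ / A k) (by positivity) (by positivity)]
        ring
    _ ≤ 2 * C * (2 * (y - x)) ^ s := by gcongr
    _ = 2 * C * (2 ^ s * (y - x) ^ s) := by rw [Real.mul_rpow (by norm_num) hyx.le]
    _ ≤ 2 * C * (2 * (y - x) ^ s) := by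
        gcongr
        simpa using Real.rpow_le_rpow_of_exponent_le (x := 2) (by norm_num) hs1
    _ = 4 * C * (y - x) ^ s := by ring

lemma le_dimH_setOf_mul_near_int {s C : ℝ} (hA : ∀ k, 0 < A k)
    (hPs : ∀ k, P (k + 1) = P k * A k) (hP0 : P 0 = 1) (hP : Tendsto P atTop atTop)
    (hq0 : ∀ k, 0 < q k) (hB : ∀ k, 2 ≤ B k) (hqs : ∀ k, q (k + 1) = q k * B k * A k)
    (hs : 0 < s) (hs1 : s ≤ 1) (hC : ∀ k, ((q k : ℝ) * B k) ^ s ≤ C * P k) :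
    ENNReal.ofReal s ≤
      dimH {x : ℝ | ∀ k, ∃ z : ℤ, (q k : ℝ) * x - z ∈ Icc (0 : ℝ) (1 / B k)} := by
  have hB0 : ∀ k, 0 < B k := fun k => lt_of_lt_of_le two_pos (hB k)
  let H : ℝ → ℝ := fun t => ⨆ k, digitSum q P A t k
  have hmono := digitSum_monotone (q := q) hA hPs
  have hanti := digitSum_add_antitone hA hPs hq0 hB0 hqs
  have hle : ∀ t j k, digitSum q P A t j ≤ digitSum q P A t k + 1 / (q k * B k) := by
    intro t j k
    have h1 := hmono t (le_max_left j k)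
    have h2 := hanti t (le_max_right j k)
    have h3 : (0 : ℝ) ≤ 1 / (q (max j k) * B (max j k)) := by positivity
    simp only at h2
    linarith
  have hupper : ∀ t k, H t ≤ digitSum q P A t k + 1 / (q k * B k) := fun t k =>
    ciSup_le fun j => hle t j k
  have hlower : ∀ t k, digitSum q P A t k ≤ H t := fun t k =>
    le_ciSup (f := digitSum q P A t) ⟨_, by rintro _ ⟨j, rfl⟩; exact hle t j 0⟩ k
  have hsub : H '' Ico 0 1 ⊆
      {x : ℝ | ∀ k, ∃ z : ℤ, (q k : ℝ) * x - z ∈ Icc (0 : ℝ) (1 / B k)} := by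
    rintro _ ⟨t, -, rfl⟩ k
    obtain ⟨z, hz⟩ := exists_int_mul_digitSum_eq (P := P) hqs hq0 t k
    have hqk : (0 : ℝ) < q k := by exact_mod_cast hq0 _
    have hBk : (0 : ℝ) < B k := by exact_mod_cast hB0 _
    refine ⟨z, ?_, ?_⟩
    · rw [← hz]
      nlinarith [hlower t k]
    · rw [← hz]
      have h1 := mul_le_mul_of_nonneg_left (hupper t k) hqk.le
      have h2 : (q k : ℝ) * (1 / (q k * B k)) = 1 / B k := by field_simp
      rw [mul_add, h2] at h1
      linarith
  have hbound : ∀ t ∈ Ico (0 : ℝ) 1, ∀ u ∈ Ico (0 : ℝ) 1, t < u →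
      edist t u ≤ (4 * C).toNNReal * edist (H t) (H u) ^ (s.toNNReal : ℝ) := by
    intro t ht u hu htu
    obtain ⟨hpos, hle⟩ := sub_le_mul_rpow_digitSum hA hPs hP0 hP hq0 hB hqs hs hs1 hC ht hu htu
      (hupper t) (hlower u)
    have hC0 : 0 ≤ 4 * C := by
      have h0 := hC 0
      rw [hP0, Nat.cast_one, mul_one] at h0
      have : (0 : ℝ) ≤ ((q 0 : ℝ) * B 0) ^ s := by positivity
      linarith
    rw [edist_comm t, edist_comm (H t), edist_dist, edist_dist, Real.dist_eq, Real.dist_eq,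
      abs_of_pos (sub_pos.mpr htu), abs_of_pos hpos, Real.coe_toNNReal _ hs.le,
      ENNReal.ofReal_rpow_of_pos hpos]
    change _ ≤ ENNReal.ofReal _ * _
    rw [← ENNReal.ofReal_mul hC0]
    exact ENNReal.ofReal_le_ofReal hle
  have hdim := dimH_le_dimH_image_div (H := H) (S := Ico 0 1) (C := (4 * C).toNNReal)
    (s := s.toNNReal) (Real.toNNReal_pos.mpr hs) (by
      intro t ht u hu
      rcases lt_trichotomy t u with h | rfl | h
      · exact hbound t ht u hu h
      · simp
      · rw [edist_comm t, edist_comm (H t)]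
        exact hbound u hu t ht h)
  have hone : dimH (Ico (0 : ℝ) 1) = 1 := by
    rw [Real.dimH_of_nonempty_interior (by simp [interior_Ico])]
    simp
  rw [hone, ENNReal.le_div_iff_mul_le (.inl (by simpa using hs)) (.inl ENNReal.coe_ne_top),
    one_mul] at hdim
  exact hdim.trans (dimH_mono hsub)

end DigitSum

lemma exists_seq_range_eq {S : Set ℕ} (hS : S.Infinite) (h0 : 0 ∉ S) :
    ∃ r : ℕ → ℕ, (∀ n, 1 ≤ r n) ∧ Tendsto r atTop atTop ∧ range r = S := by
  refine ⟨Nat.nth (· ∈ S), fun n => Nat.pos_of_ne_zero fun h => h0 ?_,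
    (Nat.nth_strictMono hS).tendsto_atTop, Nat.range_nth_of_infinite hS⟩
  have := Nat.nth_mem_of_infinite (p := (· ∈ S)) hS n
  rwa [h] at this

lemma zero_notMem_multiplesUpTo {q M : ℕ → ℕ} (hq : ∀ k, 0 < q k) : 0 ∉ multiplesUpTo q M := by
  rintro ⟨k, m, hm, -, h⟩
  exact (Nat.mul_pos hm (hq k)).ne h

lemma nearRational_one_countable (N : ℕ) :
    (nearRational (fun _ => 1) (fun k => k + 1) N).Countable := by
  refine (countable_range fun z : ℤ => (z : ℝ) / N.factorial).mono ?_
  rintro x ⟨-, hx⟩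
  have hL : (0 : ℝ) < N.factorial := by exact_mod_cast N.factorial_pos
  refine ⟨round ((N.factorial : ℝ) * x), ?_⟩
  have hlim : Tendsto (fun k : ℕ => 2 * (N.factorial : ℝ) / ((k + 1 : ℕ) : ℝ)) atTop (nhds 0) :=
    (tendsto_const_div_atTop_nhds_zero_nat _).comp (tendsto_add_atTop_nat 1)
  have hle : |(N.factorial : ℝ) * x - round ((N.factorial : ℝ) * x)| ≤ 0 :=
    ge_of_tendsto' hlim fun k => by
      obtain ⟨z, hz⟩ := hx k
      rw [Nat.cast_one, one_mul] at hz
      exact (round_le _ z).trans hz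
  have := abs_eq_zero.mp (le_antisymm hle (abs_nonneg _))
  simp only
  rw [div_eq_iff hL.ne']
  linarith

/-- Rapidly growing denominators, with room for `2 * b n` gaps after the denominator `n`. -/
def denom (b : ℕ → ℕ) : ℕ → ℕ
  | 0 => 1
  | k + 1 => (denom b k * (2 * b (denom b k))) ^ (k + 2)

lemma denom_pos {b : ℕ → ℕ} (hb : ∀ n, 0 < n → 0 < b n) (k : ℕ) : 0 < denom b k := by
  induction k with
  | zero => exact one_pos
  | succ k ih =>
    have := hb _ ih
    simp only [denom]
    positivity

lemma denom_strictMono {b : ℕ → ℕ} (hb : ∀ n, 0 < n → 0 < b n) : StrictMono (denom b) := by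
  refine strictMono_nat_of_lt_succ fun k => ?_
  have h0 := denom_pos hb k
  have h1 := hb _ h0
  calc denom b k < denom b k * (2 * b (denom b k)) := by nlinarith
    _ ≤ _ := Nat.le_self_pow (by omega) _

/-- The number of admissible digits between consecutive denominators. -/
def numDigits (b : ℕ → ℕ) (k : ℕ) : ℕ :=
  (denom b k * (2 * b (denom b k))) ^ (k + 1)

lemma two_le_numDigits {b : ℕ → ℕ} (hb : ∀ n, 0 < n → 0 < b n) (k : ℕ) : 2 ≤ numDigits b k := by
  have h0 := denom_pos hb k
  have h1 := hb _ h0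
  calc 2 ≤ denom b k * (2 * b (denom b k)) := by nlinarith
    _ ≤ _ := Nat.le_self_pow (by omega) _

lemma prod_numDigits_strictMono {b : ℕ → ℕ} (hb : ∀ n, 0 < n → 0 < b n) :
    StrictMono fun k => ∏ i ∈ Finset.range k, numDigits b i := by
  refine strictMono_nat_of_lt_succ fun k => ?_
  have h : 0 < ∏ i ∈ Finset.range k, numDigits b i :=
    Finset.prod_pos fun i _ => two_pos.trans_le (two_le_numDigits hb i)
  rw [Finset.prod_range_succ]
  nlinarith [two_le_numDigits hb k]

lemma exists_rpow_denom_le {b : ℕ → ℕ} {d s : ℝ} (hb : ∀ n, 0 < n → 0 < b n) (hd : 0 < d)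
    (hd1 : d ≤ 1) (hs : 0 < s) (hsd : s < d)
    (hbd : ∀ n : ℕ, 0 < n → (n : ℝ) * (2 * b n) ≤ 4 * (n : ℝ) ^ d⁻¹) :
    ∃ C : ℝ, ∀ k, ((denom b k : ℝ) * ((2 * b (denom b k) : ℕ) : ℝ)) ^ s ≤
      C * (∏ i ∈ Finset.range k, numDigits b i : ℕ) := by
  have hP : ∀ k, (0 : ℝ) < (∏ i ∈ Finset.range k, numDigits b i : ℕ) := fun k => by
    exact_mod_cast Finset.prod_pos fun i _ => two_pos.trans_le (two_le_numDigits hb i)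
  have hev : ∀ᶠ k in atTop, ((denom b k : ℝ) * ((2 * b (denom b k) : ℕ) : ℝ)) ^ s /
      (∏ i ∈ Finset.range k, numDigits b i : ℕ) ≤ 4 := by
    have hθ : s / d < 1 := (div_lt_one hd).mpr hsd
    obtain ⟨K, hK⟩ := exists_nat_ge (1 / (1 - s / d))
    filter_upwards [eventually_ge_atTop (K + 1)] with k hk
    obtain ⟨j, rfl⟩ : ∃ j, k = j + 1 := ⟨k - 1, by omega⟩
    rw [div_le_iff₀ (hP _)]
    set w : ℕ := denom b j * (2 * b (denom b j)) with hw
    have hw1 : (1 : ℝ) ≤ w := by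
      have : 0 < w := by
        have h0 := denom_pos hb j
        have h1 := hb _ h0
        positivity
      exact_mod_cast this
    have hexp : ((j : ℝ) + 2) * (s / d) ≤ j + 1 := by
      rw [div_le_iff₀ (by linarith)] at hK
      have hKj : (K : ℝ) ≤ j := by exact_mod_cast (by omega : K ≤ j)
      nlinarith
    have hq : (denom b (j + 1) : ℝ) = (w : ℝ) ^ ((j : ℝ) + 2) := by
      simp only [denom]
      rw [← hw]
      push_cast
      exact_mod_cast (Real.rpow_natCast (w : ℝ) (j + 2)).symm
    have hA : (numDigits b j : ℝ) = (w : ℝ) ^ ((j : ℝ) + 1) := by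
      simp only [numDigits]
      rw [← hw]
      push_cast
      exact_mod_cast (Real.rpow_natCast (w : ℝ) (j + 1)).symm
    have hq0 : (0 : ℝ) ≤ denom b (j + 1) := Nat.cast_nonneg _
    have hbq := hbd _ (denom_pos hb (j + 1))
    calc ((denom b (j + 1) : ℝ) * ((2 * b (denom b (j + 1)) : ℕ) : ℝ)) ^ s
        ≤ (4 * (denom b (j + 1) : ℝ) ^ d⁻¹) ^ s := by
          push_cast
          exact Real.rpow_le_rpow (by positivity) hbq hs.le
      _ = 4 ^ s * (w : ℝ) ^ (((j : ℝ) + 2) * (s / d)) := by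
          rw [Real.mul_rpow (by norm_num) (by positivity), ← Real.rpow_mul hq0, hq,
            ← Real.rpow_mul (by positivity), div_eq_inv_mul]
      _ ≤ 4 ^ (1 : ℝ) * (w : ℝ) ^ ((j : ℝ) + 1) := by
          gcongr
          · norm_num
          · linarith
      _ = 4 * numDigits b j := by rw [Real.rpow_one, hA]
      _ ≤ 4 * (∏ i ∈ Finset.range (j + 1), numDigits b i : ℕ) := by
          rw [Finset.prod_range_succ, Nat.cast_mul]
          have h1 : (1 : ℝ) ≤ (∏ i ∈ Finset.range j, numDigits b i : ℕ) := by
            have := hP j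
            exact_mod_cast this
          have : (0 : ℝ) ≤ numDigits b j := Nat.cast_nonneg _
          nlinarith
  obtain ⟨C, hC⟩ := (isBoundedUnder_of_eventually_le hev).bddAbove_range
  exact ⟨C, fun k => (div_le_iff₀ (hP k)).mp (hC (mem_range_self k))⟩

/-- For every `0 ≤ d ≤ 1` there is a sequence of positive integers tending to `∞`
whose exceptional set for density modulo 1 has Hausdorff dimension `d`. -/
theorem exists_seq_dimH_E_eq (d : ℝ) (hd0 : 0 ≤ d) (hd1 : d ≤ 1) :
    ∃ r : ℕ → ℕ, (∀ n, 1 ≤ r n) ∧ Tendsto r atTop atTop ∧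
      dimH (Eset r) = ENNReal.ofReal d := by
  rcases hd0.eq_or_lt with rfl | hd
  · have hinf : (multiplesUpTo (fun _ => 1) fun k => k + 1).Infinite :=
      infinite_of_injective_forall_mem (f := Nat.succ) Nat.succ_injective fun k =>
        ⟨k, k + 1, by omega, le_rfl, by simp⟩
    obtain ⟨r, hr1, hr, hrange⟩ := exists_seq_range_eq hinf (zero_notMem_multiplesUpTo (by simp))
    refine ⟨r, hr1, hr, ?_⟩
    rw [ENNReal.ofReal_zero]
    exact dimH_countable ((countable_iUnion nearRational_one_countable).mono
      (Eset_subset_iUnion_nearRational (fun _ => Nat.succ_pos _) hrange))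
  · obtain ⟨b, hbdef⟩ : ∃ b : ℕ → ℕ, ∀ n, b n = ⌈(n : ℝ) ^ (d⁻¹ - 1)⌉₊ := ⟨_, fun _ => rfl⟩
    have hτ : 0 ≤ d⁻¹ - 1 := sub_nonneg.mpr ((one_le_inv₀ hd).mpr hd1)
    have hb : ∀ n, 0 < n → 0 < b n := fun n hn => by
      rw [hbdef, Nat.ceil_pos]
      exact Real.rpow_pos_of_pos (by exact_mod_cast hn) _
    have hsplit : ∀ n : ℕ, 0 < n → (n : ℝ) ^ d⁻¹ = n * (n : ℝ) ^ (d⁻¹ - 1) := fun n hn => by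
      have hn' : (0 : ℝ) < n := by exact_mod_cast hn
      rw [Real.rpow_sub_one hn'.ne']
      field_simp
    have hlow : ∀ n : ℕ, 0 < n → (n : ℝ) ^ d⁻¹ ≤ n * b n := fun n hn => by
      rw [hsplit n hn, hbdef]
      gcongr
      exact Nat.le_ceil _
    have hup : ∀ n : ℕ, 0 < n → (n : ℝ) * (2 * b n) ≤ 4 * (n : ℝ) ^ d⁻¹ := fun n hn => by
      have hn1 : (1 : ℝ) ≤ n := by exact_mod_cast hn
      have h1 : 1 ≤ (n : ℝ) ^ (d⁻¹ - 1) := Real.one_le_rpow hn1 hτ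
      have h2 : (b n : ℝ) ≤ 2 * (n : ℝ) ^ (d⁻¹ - 1) := by
        rw [hbdef]
        linarith [Nat.ceil_lt_add_one (a := (n : ℝ) ^ (d⁻¹ - 1)) (by positivity)]
      rw [hsplit n hn]
      nlinarith
    let q := denom b
    let M := fun k => b (q k)
    have hq0 : ∀ k, 0 < q k := denom_pos hb
    have hqm : StrictMono q := denom_strictMono hb
    have hM0 : ∀ k, 0 < M k := fun k => hb _ (hq0 k)
    have hinf : (multiplesUpTo q M).Infinite :=
      infinite_of_injective_forall_mem hqm.injective fun k => ⟨k, 1, le_rfl, hM0 k, by simp⟩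
    obtain ⟨r, hr1, hr, hrange⟩ := exists_seq_range_eq hinf (zero_notMem_multiplesUpTo hq0)
    refine ⟨r, hr1, hr, le_antisymm ?_ ?_⟩
    · refine (dimH_mono (Eset_subset_iUnion_nearRational hM0 hrange)).trans ?_
      rw [dimH_iUnion]
      exact iSup_le fun N =>
        dimH_nearRational_le hd hqm.tendsto_atTop hq0 (fun k => hlow _ (hq0 k)) N
    · refine le_of_forall_lt fun c hc => ?_
      obtain ⟨s, hcs, hsd⟩ := ENNReal.lt_iff_exists_nnreal_btwn.mp hc
      have hs : (0 : ℝ) < s := by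
        exact_mod_cast (zero_le (a := c)).trans_lt hcs
      have hsd' : (s : ℝ) < d := by
        rw [← ENNReal.ofReal_coe_nnreal] at hsd
        exact (ENNReal.ofReal_lt_ofReal_iff hd).mp hsd
      obtain ⟨C, hC⟩ := exists_rpow_denom_le hb hd hd1 hs hsd' hup
      have hdim := le_dimH_setOf_mul_near_int (q := q) (B := fun k => 2 * M k)
        (A := numDigits b)
        (P := fun k => ∏ i ∈ Finset.range k, numDigits b i)
        (fun k => two_pos.trans_le (two_le_numDigits hb k))
        (fun k => Finset.prod_range_succ _ _) (Finset.prod_range_zero _)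
        (prod_numDigits_strictMono hb).tendsto_atTop hq0
        (fun k => by have := hM0 k; omega)
        (fun k => by simp only [q, M, denom, numDigits]; ring) hs (by linarith) hC
      rw [ENNReal.ofReal_coe_nnreal] at hdim
      exact hcs.trans_le (hdim.trans (dimH_mono (subset_Eset (fun _ => rfl) hrange)))
end

section
/- For every real number d with 0 ≤ d ≤ 1, there exists a sequence (r_n)_{n≥1} of positive integers with r_n → ∞ such that the Hausdorff dimension of E_0(r) equals d and the Hausdorff dimension of E_f(r) equals d. -/
open Filter Set

/-- Distance from `t` to the nearest integer. -/
noncomputable def distNearestInt (t : ℝ) : ℝ := |t - round t|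

/-- `E0 r` is the set of reals `x` with `‖r_n x‖ → 0`. -/
noncomputable def E0 (r : ℕ → ℕ) : Set ℝ :=
  {x | Tendsto (fun n : ℕ => distNearestInt ((r n : ℝ) * x)) atTop (nhds 0)}

/-- `Ef r` is the set of reals `x` with `∑ ‖r_n x‖ < ∞`. -/
noncomputable def Ef (r : ℕ → ℕ) : Set ℝ :=
  {x | Summable fun n : ℕ => distNearestInt ((r n : ℝ) * x)}

open MeasureTheory Metric
open scoped ENNReal NNReal Topology

lemma distNearestInt_nonneg (t : ℝ) : 0 ≤ distNearestInt t := abs_nonneg _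

lemma distNearestInt_le (t : ℝ) (m : ℤ) : distNearestInt t ≤ |t - m| := round_le t m

lemma two_mul_distNearestInt_le {t : ℝ} (ht : distNearestInt t < 1 / 4) :
    2 * distNearestInt t ≤ distNearestInt (2 * t) := by
  unfold distNearestInt at *
  by_cases h : round (2 * t) = 2 * round t
  · rw [h]
    push_cast
    rw [← mul_sub, abs_mul, abs_two]
  · have h1 : (1 : ℝ) ≤ |((round (2 * t) - 2 * round t : ℤ) : ℝ)| := by
      exact_mod_cast Int.one_le_abs (sub_ne_zero.2 h)
    push_cast at h1
    have h2 := abs_sub_abs_le_abs_sub ((round (2 * t) : ℝ) - 2 * round t) (2 * t - 2 * round t)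
    rw [show (round (2 * t) : ℝ) - 2 * round t - (2 * t - 2 * round t)
      = -(2 * t - round (2 * t)) by ring, abs_neg, ← mul_sub, abs_mul, abs_two] at h2
    linarith

lemma two_pow_mul_distNearestInt_le {t : ℝ} (n : ℕ)
    (ht : ∀ i < n, distNearestInt (2 ^ i * t) < 1 / 4) :
    2 ^ n * distNearestInt t ≤ distNearestInt (2 ^ n * t) := by
  induction n with
  | zero => simp
  | succ n ih =>
    have h1 := ih fun i hi => ht i (hi.trans n.lt_succ_self)
    have h2 := two_mul_distNearestInt_le (ht n n.lt_succ_self)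
    rw [pow_succ', mul_assoc, mul_assoc]
    linarith

/-- The start of the `j`-th block of binary digits. The `j`-th block consists of
`G (j + 1) - G j + (2 * j + 1)` prescribed digits followed by `F (j + 1) - F j` free digits. -/
def blockStart (F G : ℕ → ℕ) (j : ℕ) : ℕ := F j + G j + j ^ 2

section Blocks

variable {F G : ℕ → ℕ}

lemma blockStart_succ (hF : Monotone F) (hG : Monotone G) (j : ℕ) :
    blockStart F G (j + 1) =
      blockStart F G j + ((G (j + 1) - G j + (2 * j + 1)) + (F (j + 1) - F j)) := by
  have := hF j.le_succ
  have := hG j.le_succ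
  simp only [blockStart, Nat.succ_eq_add_one, add_sq] at *
  omega

lemma strictMono_blockStart (hF : Monotone F) (hG : Monotone G) :
    StrictMono (blockStart F G) :=
  strictMono_nat_of_lt_succ fun j => by rw [blockStart_succ hF hG]; omega

/-- The exponents `k` such that `2 ^ k` occurs in the sequence attached to `F` and `G`. -/
def blockExponent (F G : ℕ → ℕ) (p : Σ j : ℕ, Fin (G (j + 1) - G j + 1)) : ℕ :=
  blockStart F G p.1 + p.2

lemma injective_blockExponent (hF : Monotone F) (hG : Monotone G) :
    Function.Injective (blockExponent F G) := by
  have key : ∀ p q : Σ j : ℕ, Fin (G (j + 1) - G j + 1), p.1 < q.1 →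
      blockExponent F G p < blockExponent F G q := by
    rintro ⟨j, i⟩ ⟨k, l⟩ h
    have h1 := (strictMono_blockStart hF hG).monotone (Nat.succ_le_of_lt h)
    have h2 := blockStart_succ hF hG j
    have h3 := i.2
    simp only [blockExponent, Nat.succ_eq_add_one] at *
    omega
  rintro ⟨j, i⟩ ⟨k, l⟩ h
  obtain hjk | rfl | hjk := lt_trichotomy j k
  · exact absurd h (key ⟨j, i⟩ ⟨k, l⟩ hjk).ne
  · have hil : i = l := Fin.ext (Nat.add_left_cancel h)
    rw [hil]
  · exact absurd h (key ⟨k, l⟩ ⟨j, i⟩ hjk).ne'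

lemma infinite_sigma_fin_succ (n : ℕ → ℕ) : Infinite (Σ j : ℕ, Fin (n j + 1)) :=
  Infinite.of_injective (fun j => ⟨j, 0⟩) fun _ _ h => congrArg Sigma.fst h

lemma summable_distNearestInt_blockExponent {x : ℝ}
    (hx : ∀ j, ∃ m : ℤ, |2 ^ blockStart F G j * x - m| ≤
      1 / 2 ^ (G (j + 1) - G j + (2 * j + 1))) :
    Summable fun p => distNearestInt ((2 ^ blockExponent F G p : ℝ) * x) := by
  rw [summable_sigma_of_nonneg fun _ => distNearestInt_nonneg _]
  refine ⟨fun j => Summable.of_finite, ?_⟩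
  refine Summable.of_nonneg_of_le (fun j => tsum_nonneg fun _ => distNearestInt_nonneg _)
    (fun j => ?_) (summable_geometric_of_lt_one (r := 1 / 4) (by norm_num) (by norm_num))
  obtain ⟨m, hm⟩ := hx j
  rw [tsum_fintype]
  set g := G (j + 1) - G j
  have h1 : ∀ i : Fin (g + 1),
      distNearestInt ((2 ^ blockExponent F G ⟨j, i⟩ : ℝ) * x) ≤
        2 ^ (i : ℕ) * (1 / 2 ^ (g + (2 * j + 1))) := fun i => by
    refine (distNearestInt_le _ (2 ^ (i : ℕ) * m)).trans ?_
    have : (2 ^ blockExponent F G ⟨j, i⟩ : ℝ) * x - ((2 ^ (i : ℕ) * m : ℤ) : ℝ) =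
        2 ^ (i : ℕ) * (2 ^ blockStart F G j * x - m) := by
      simp only [blockExponent]
      push_cast
      ring
    rw [this, abs_mul, abs_of_pos (by positivity : (0 : ℝ) < 2 ^ (i : ℕ))]
    gcongr
  refine (Finset.sum_le_sum fun i _ => h1 i).trans ?_
  rw [← Finset.sum_mul, Fin.sum_univ_eq_sum_range (fun i => (2 : ℝ) ^ i) (g + 1),
    geom_sum_eq (by norm_num)]
  have : (1 / 4 : ℝ) ^ j = 2 ^ (g + 1) * (1 / 2 ^ (g + (2 * j + 1))) := by
    rw [show g + (2 * j + 1) = (g + 1) + 2 * j by ring, pow_add _ (g + 1), pow_mul, div_pow]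
    norm_num
    field_simp
  rw [this]
  gcongr
  norm_num

lemma eventually_distNearestInt_le_of_tendsto {x : ℝ}
    (hx : Tendsto (fun p => distNearestInt ((2 ^ blockExponent F G p : ℝ) * x)) cofinite (𝓝 0)) :
    ∃ J, ∀ j ≥ J, 2 ^ (G (j + 1) - G j) * distNearestInt (2 ^ blockStart F G j * x) ≤ 1 / 4 := by
  have h := hx.eventually_lt_const (show (0 : ℝ) < 1 / 4 by norm_num)
  rw [eventually_cofinite] at h
  obtain ⟨J, hJ⟩ := (h.image Sigma.fst).bddAbove
  refine ⟨J + 1, fun j hj => ?_⟩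
  have key : ∀ i < G (j + 1) - G j + 1,
      distNearestInt (2 ^ i * (2 ^ blockStart F G j * x)) < 1 / 4 := fun i hi => by
    by_contra hcon
    have : j ≤ J := hJ ⟨⟨j, i, hi⟩, by
      simp only [mem_ofPred_eq, blockExponent, pow_add]
      rwa [mul_comm (2 ^ _ : ℝ) (2 ^ i), mul_assoc], rfl⟩
    omega
  exact (two_pow_mul_distNearestInt_le _ fun i hi => key i (hi.trans (Nat.lt_succ_self _))).trans
    (key _ (Nat.lt_succ_self _)).le

/-- The points whose dyadic approximations of order `blockStart F G j` are good for all
`j ≥ J`, and whose approximation of order `blockStart F G J` is `p`. -/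
def goodApprox (F G : ℕ → ℕ) (J : ℕ) (p : ℤ) : Set ℝ :=
  {x | round (2 ^ blockStart F G J * x) = p ∧
    ∀ j ≥ J, 2 ^ (G (j + 1) - G j) * distNearestInt (2 ^ blockStart F G j * x) ≤ 1 / 4}

lemma exists_finset_round_mem (hF : Monotone F) (hG : Monotone G) (J : ℕ) (p : ℤ) (j : ℕ)
    (hj : J ≤ j) :
    ∃ P : Finset ℤ, P.card ≤ 2 ^ (F j + j ^ 2 + 2 * j) ∧
      ∀ x ∈ goodApprox F G J p, round (2 ^ blockStart F G j * x) ∈ P := by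
  induction j, hj using Nat.le_induction with
  | base =>
    exact ⟨{p}, by simpa using Nat.one_le_two_pow, fun x hx => by simpa using hx.1⟩
  | succ j hj ih =>
    obtain ⟨P, hP, hPx⟩ := ih
    set f := F (j + 1) - F j with hf
    set g := G (j + 1) - G j with hg
    set n := (g + (2 * j + 1)) + f with hn
    have hT : blockStart F G (j + 1) = blockStart F G j + n := blockStart_succ hF hG j
    refine ⟨P.biUnion fun q => Finset.Icc (2 ^ n * q - 2 ^ (f + 2 * j + 1))
      (2 ^ n * q + 2 ^ (f + 2 * j + 1)), ?_, fun x hx => ?_⟩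
    · refine (Finset.card_biUnion_le_card_mul _ _ (2 ^ (f + 2 * j + 3)) fun q _ => ?_).trans ?_
      · rw [Int.card_Icc, Int.toNat_le]
        push_cast
        have : (1 : ℤ) ≤ 2 ^ (f + 2 * j + 1) := one_le_pow₀ (by norm_num)
        rw [pow_add 2 (f + 2 * j) 3]
        rw [pow_add 2 (f + 2 * j) 1] at *
        linarith
      · refine (Nat.mul_le_mul_right _ hP).trans ?_
        rw [← pow_add]
        refine Nat.pow_le_pow_right (by norm_num) ?_
        have := hF j.le_succ
        simp only [Nat.succ_eq_add_one] at this
        nlinarith [Nat.add_sub_of_le this]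
    · rw [Finset.mem_biUnion]
      refine ⟨_, hPx x hx, ?_⟩
      have h1 := hx.2 j hj
      rw [← hg, distNearestInt] at h1
      set y := 2 ^ blockStart F G j * x with hy
      set q := round y
      have h2 : 2 ^ blockStart F G (j + 1) * x = 2 ^ n * y := by
        rw [hT, hy, pow_add]; ring
      rw [h2]
      have h3 : |(2 : ℝ) ^ n * y - 2 ^ n * q| ≤ 2 ^ (f + 2 * j + 1) * (1 / 4) := by
        rw [← mul_sub, abs_mul, abs_of_pos (by positivity : (0 : ℝ) < 2 ^ n),
          show n = (f + 2 * j + 1) + g by omega, pow_add, mul_assoc]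
        gcongr
      have h4 := abs_sub_round ((2 : ℝ) ^ n * y)
      have h5 : (1 : ℝ) ≤ 2 ^ (f + 2 * j + 1) := one_le_pow₀ (by norm_num)
      have h6 : |((round ((2 : ℝ) ^ n * y) - 2 ^ n * q : ℤ) : ℝ)| ≤
          ((2 ^ (f + 2 * j + 1) : ℤ) : ℝ) := by
        push_cast
        rw [abs_le] at *
        constructor <;> linarith [h3.1, h3.2, h4.1, h4.2]
      rw [← Int.cast_abs, Int.cast_le, abs_le] at h6
      rw [Finset.mem_Icc]
      constructor <;> linarith [h6.1, h6.2]

lemma dimH_goodApprox_le (hF : Monotone F) (hG : Monotone G) (J : ℕ) (p : ℤ) {s : ℝ≥0}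
    (hs : ∀ᶠ j : ℕ in atTop, (F j + j ^ 2 + 2 * j : ℝ) ≤ s * blockStart F G j) :
    dimH (goodApprox F G J p) ≤ s := by
  choose P hP hPx using fun k => exists_finset_round_mem hF hG J p (J + k) (Nat.le_add_right J k)
  refine dimH_le_of_hausdorffMeasure_ne_top (ne_top_of_le_ne_top ENNReal.one_ne_top ?_)
  set T : ℕ → ℕ := fun k => blockStart F G (J + k)
  set t : ∀ k, P k → Set ℝ := fun k q => {x | round (2 ^ T k * x) = (q : ℤ)} with ht
  have hT : Tendsto T atTop atTop :=
    (strictMono_blockStart hF hG).tendsto_atTop.comp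
      (tendsto_atTop_mono (Nat.le_add_left · J) tendsto_id)
  have hdiam : ∀ k q, ediam (t k q) ≤ ENNReal.ofReal ((1 / 2) ^ T k) := fun k q => by
    refine ediam_le_of_forall_dist_le fun x hx y hy => ?_
    have h1 := abs_sub_round ((2 : ℝ) ^ T k * x)
    have h2 := abs_sub_round ((2 : ℝ) ^ T k * y)
    rw [show round ((2 : ℝ) ^ T k * x) = q from hx] at h1
    rw [show round ((2 : ℝ) ^ T k * y) = q from hy] at h2
    have h3 : |(2 : ℝ) ^ T k * (x - y)| ≤ 1 := by
      rw [abs_le] at *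
      constructor <;> linarith [h1.1, h1.2, h2.1, h2.2]
    rw [abs_mul, abs_of_pos (by positivity : (0 : ℝ) < 2 ^ T k)] at h3
    rwa [Real.dist_eq, one_div, inv_pow, ← one_div, le_div_iff₀' (by positivity)]
  refine (Measure.hausdorffMeasure_le_liminf_sum (s : ℝ) (goodApprox F G J p) (l := atTop)
    (fun k => ENNReal.ofReal ((1 / 2) ^ T k)) ?_ t (Eventually.of_forall hdiam)
    (Eventually.of_forall fun k x hx => mem_iUnion.2 ⟨⟨_, hPx k x hx⟩, rfl⟩)).trans ?_
  · rw [← ENNReal.ofReal_zero]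
    exact ENNReal.tendsto_ofReal
      ((tendsto_pow_atTop_nhds_zero_of_lt_one (by norm_num) (by norm_num)).comp hT)
  · have hJ : Tendsto (fun k => J + k) atTop atTop :=
      tendsto_atTop_mono (Nat.le_add_left · J) tendsto_id
    refine liminf_le_of_frequently_le' (Eventually.frequently ?_)
    filter_upwards [hJ.eventually hs] with k hk
    calc ∑ i, ediam (t k i) ^ (s : ℝ)
        ≤ ∑ _i : P k, ENNReal.ofReal ((1 / 2) ^ T k) ^ (s : ℝ) := by
          gcongr with i
          exact hdiam k i
      _ = ENNReal.ofReal ((P k).card * ((1 / 2) ^ T k) ^ (s : ℝ)) := by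
          rw [Finset.sum_const, Finset.card_univ, Fintype.card_coe, nsmul_eq_mul,
            ENNReal.ofReal_rpow_of_pos (by positivity), ENNReal.ofReal_mul (by positivity),
            ENNReal.ofReal_natCast]
      _ ≤ 1 := by
          rw [ENNReal.ofReal_le_one]
          calc ((P k).card * ((1 / 2) ^ T k) ^ (s : ℝ) : ℝ)
              ≤ 2 ^ (F (J + k) + (J + k) ^ 2 + 2 * (J + k)) * ((1 / 2) ^ T k) ^ (s : ℝ) := by
                gcongr
                exact_mod_cast hP k
            _ = (2 : ℝ) ^ ((F (J + k) + (J + k : ℕ) ^ 2 + 2 * (J + k : ℕ) : ℝ) - s * T k) := by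
                rw [Real.rpow_sub two_pos, one_div, inv_pow, Real.inv_rpow (by positivity),
                  ← Real.rpow_natCast, ← Real.rpow_natCast, ← Real.rpow_mul two_pos.le,
                  mul_comm (s : ℝ), div_eq_mul_inv]
                push_cast
                rfl
            _ ≤ 1 := Real.rpow_le_one_of_one_le_of_nonpos one_le_two (by
                simp only [T]
                linarith)

/-- The integer whose binary digits are the first `blockStart F G j` digits of `spread F G y`. -/
noncomputable def spreadInt (F G : ℕ → ℕ) (y : ℝ) : ℕ → ℤ
  | 0 => 0
  | j + 1 => 2 ^ (G (j + 1) - G j + (2 * j + 1) + (F (j + 1) - F j)) * spreadInt F G y j +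
      (⌊2 ^ F (j + 1) * y⌋ - 2 ^ (F (j + 1) - F j) * ⌊2 ^ F j * y⌋)

/-- The point whose free binary digits are the digits of `y` and whose prescribed binary digits
are zero. -/
noncomputable def spread (F G : ℕ → ℕ) (y : ℝ) : ℝ :=
  ⨆ j, (spreadInt F G y j : ℝ) / 2 ^ blockStart F G j

lemma floor_pow_mul_sub_mem (y : ℝ) {m n : ℕ} (h : m ≤ n) :
    ⌊2 ^ n * y⌋ - 2 ^ (n - m) * ⌊2 ^ m * y⌋ ∈ Ico (0 : ℤ) (2 ^ (n - m)) := by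
  obtain ⟨k, rfl⟩ := Nat.exists_eq_add_of_le h
  rw [Nat.add_sub_cancel_left, pow_add, mul_comm ((2 : ℝ) ^ m), mul_assoc]
  set z := 2 ^ m * y
  have hk : (0 : ℝ) < 2 ^ k := by positivity
  constructor
  · rw [sub_nonneg, Int.le_floor]
    push_cast
    exact mul_le_mul_of_nonneg_left (Int.floor_le z) hk.le
  · rw [sub_lt_iff_lt_add, Int.floor_lt]
    push_cast
    nlinarith [Int.lt_floor_add_one z]

lemma spread_mem_Icc (hF : Monotone F) (hG : Monotone G) (y : ℝ) (j : ℕ) :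
    spread F G y ∈ Icc ((spreadInt F G y j : ℝ) / 2 ^ blockStart F G j)
      ((spreadInt F G y j : ℝ) / 2 ^ blockStart F G j +
        1 / 2 ^ blockStart F G j / 2 ^ (G (j + 1) - G j + (2 * j + 1))) := by
  set u : ℕ → ℝ := fun j => (spreadInt F G y j : ℝ) / 2 ^ blockStart F G j with hu
  set v : ℕ → ℝ := fun j => u j +
    1 / 2 ^ blockStart F G j / 2 ^ (G (j + 1) - G j + (2 * j + 1)) with hv
  have hstep : ∀ j, u j ≤ u (j + 1) ∧ v (j + 1) ≤ v j := fun j => by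
    obtain ⟨h0, h1⟩ := floor_pow_mul_sub_mem y (hF j.le_succ)
    rw [Int.lt_iff_add_one_le] at h1
    simp only [Nat.succ_eq_add_one] at h0 h1
    set b := ⌊2 ^ F (j + 1) * y⌋ - 2 ^ (F (j + 1) - F j) * ⌊2 ^ F j * y⌋ with hb
    have h0' : (0 : ℝ) ≤ b := by exact_mod_cast h0
    have h1' : (b : ℝ) + 1 ≤ 2 ^ (F (j + 1) - F j) := by exact_mod_cast h1
    have hu1 : u (j + 1) = u j + b / 2 ^ blockStart F G (j + 1) := by
      simp only [hu, spreadInt, ← hb, blockStart_succ hF hG j]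
      push_cast
      field_simp
      ring
    refine ⟨?_, ?_⟩
    · rw [hu1]
      have : 0 ≤ (b : ℝ) / 2 ^ blockStart F G (j + 1) := by positivity
      linarith
    · simp only [hv]
      rw [hu1]
      have h2 : 1 / (2 : ℝ) ^ blockStart F G (j + 1) /
          2 ^ (G (j + 1 + 1) - G (j + 1) + (2 * (j + 1) + 1)) ≤
            1 / 2 ^ blockStart F G (j + 1) :=
        div_le_self (by positivity) (one_le_pow₀ one_le_two)
      have h3 : 1 / (2 : ℝ) ^ blockStart F G j / 2 ^ (G (j + 1) - G j + (2 * j + 1)) =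
          2 ^ (F (j + 1) - F j) / 2 ^ blockStart F G (j + 1) := by
        rw [blockStart_succ hF hG j]
        field_simp
        ring
      have h4 : ((b : ℝ) + 1) / 2 ^ blockStart F G (j + 1) ≤
          2 ^ (F (j + 1) - F j) / 2 ^ blockStart F G (j + 1) := by gcongr
      rw [add_div] at h4
      linarith
  have h := (monotone_nat_of_le_succ fun j => (hstep j).1).ciSup_mem_iInter_Icc_of_antitone
    (antitone_nat_of_succ_le fun j => (hstep j).2) fun j => by
      simp only [hv]
      exact le_add_of_nonneg_right (by positivity)
  exact mem_iInter.1 h j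

lemma abs_mul_spread_sub_le (hF : Monotone F) (hG : Monotone G) (y : ℝ) (j : ℕ) :
    |2 ^ blockStart F G j * spread F G y - spreadInt F G y j| ≤
      1 / 2 ^ (G (j + 1) - G j + (2 * j + 1)) := by
  obtain ⟨h0, h1⟩ := spread_mem_Icc hF hG y j
  have hT : (0 : ℝ) < 2 ^ blockStart F G j := by positivity
  rw [div_le_iff₀' hT] at h0
  rw [← sub_le_iff_le_add', div_right_comm, le_div_iff₀' hT, mul_sub,
    mul_div_cancel₀ _ hT.ne'] at h1
  rw [abs_of_nonneg (by linarith)]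
  exact h1

lemma exists_le_pow_and_pow_le_spread_sub (hF : Monotone F) (hG : Monotone G) (hF0 : F 0 = 0)
    (hF' : Tendsto F atTop atTop) {y y' : ℝ} (hy : y ∈ Ico (0 : ℝ) 1) (hy' : y' ∈ Ico (0 : ℝ) 1)
    (hyy' : y < y') :
    ∃ j, y' - y ≤ 1 / 2 ^ F j ∧
      1 / 2 ^ (blockStart F G (j + 1) + 1) ≤ spread F G y' - spread F G y := by
  have hex : ∃ j, ⌊2 ^ F j * y⌋ ≠ ⌊2 ^ F j * y'⌋ := by
    have h1 : Tendsto (fun j => (2 : ℝ) ^ F j * (y' - y)) atTop atTop :=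
      ((tendsto_pow_atTop_atTop_of_one_lt one_lt_two).comp hF').atTop_mul_const (sub_pos.2 hyy')
    obtain ⟨j, hj⟩ := (h1.eventually_ge_atTop 1).exists
    refine ⟨j, fun h => ?_⟩
    have h2 := Int.abs_sub_lt_one_of_floor_eq_floor h
    rw [abs_lt] at h2
    linarith [h2.1]
  classical
  obtain ⟨j, hj⟩ : ∃ j, Nat.find hex = j + 1 := Nat.exists_eq_succ_of_ne_zero fun h => by
    have := Nat.find_spec hex
    rw [h, hF0, pow_zero, one_mul, one_mul, Int.floor_eq_zero_iff.2 hy,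
      Int.floor_eq_zero_iff.2 hy'] at this
    exact this rfl
  have hne := Nat.find_spec hex
  have heq : ∀ i ≤ j, ⌊2 ^ F i * y⌋ = ⌊2 ^ F i * y'⌋ := fun i hi =>
    not_not.1 (Nat.find_min hex (by omega))
  rw [hj] at hne
  have hspread : ∀ i ≤ j, spreadInt F G y i = spreadInt F G y' i := by
    intro i
    induction i with
    | zero => exact fun _ => rfl
    | succ i ih =>
      intro hi
      rw [spreadInt, spreadInt, ih (by omega), heq _ hi, heq i (by omega)]
  have hlt : ⌊2 ^ F (j + 1) * y⌋ < ⌊2 ^ F (j + 1) * y'⌋ :=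
    lt_of_le_of_ne (Int.floor_mono (by gcongr)) hne
  have hlt' : spreadInt F G y (j + 1) + 1 ≤ spreadInt F G y' (j + 1) := by
    rw [spreadInt, spreadInt, hspread j le_rfl, heq j le_rfl]
    linarith [Int.add_one_le_iff.2 hlt]
  refine ⟨j, ?_, ?_⟩
  · have h2 := Int.abs_sub_lt_one_of_floor_eq_floor (heq j le_rfl)
    rw [abs_lt] at h2
    rw [le_div_iff₀' (by positivity)]
    linarith [h2.1]
  · have h1 := (spread_mem_Icc hF hG y (j + 1)).2
    have h2 := (spread_mem_Icc hF hG y' (j + 1)).1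
    have h3 : ((spreadInt F G y (j + 1) : ℝ) + 1) / 2 ^ blockStart F G (j + 1) ≤
        spreadInt F G y' (j + 1) / 2 ^ blockStart F G (j + 1) := by
      gcongr
      exact_mod_cast hlt'
    have h4 : 1 / (2 : ℝ) ^ blockStart F G (j + 1) /
        2 ^ (G (j + 1 + 1) - G (j + 1) + (2 * (j + 1) + 1)) ≤
          1 / 2 ^ blockStart F G (j + 1) / 2 ^ 1 := by
      gcongr
      · exact one_le_two
      · omega
    have h5 : (1 : ℝ) / 2 ^ (blockStart F G (j + 1) + 1) =
        1 / 2 ^ blockStart F G (j + 1) / 2 ^ 1 := by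
      rw [pow_add, div_div]
    rw [add_div] at h3
    rw [h5]
    linarith

lemma le_dimH_range_spread (hF : Monotone F) (hG : Monotone G) (hF0 : F 0 = 0)
    (hF' : Tendsto F atTop atTop) {s : ℝ≥0} (hs0 : 0 < s) {c : ℝ}
    (hs : ∀ j, s * (blockStart F G (j + 1) + 1 : ℝ) ≤ F j + c) :
    s ≤ dimH (range (spread F G)) := by
  have key : ∀ {y y'}, y ∈ Ico (0 : ℝ) 1 → y' ∈ Ico (0 : ℝ) 1 → y < y' →
      0 < spread F G y' - spread F G y ∧
        y' - y ≤ 2 ^ c * (spread F G y' - spread F G y) ^ (s : ℝ) := by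
    intro y y' hy hy' hyy'
    obtain ⟨j, h1, h2⟩ := exists_le_pow_and_pow_le_spread_sub hF hG hF0 hF' hy hy' hyy'
    refine ⟨lt_of_lt_of_le (by positivity) h2, h1.trans ?_⟩
    calc (1 : ℝ) / 2 ^ F j = 2 ^ (-(F j : ℝ)) := by
          rw [Real.rpow_neg two_pos.le, Real.rpow_natCast, one_div]
      _ ≤ 2 ^ (c + -(blockStart F G (j + 1) + 1 : ℝ) * s) := by
          apply Real.rpow_le_rpow_of_exponent_le one_le_two
          linarith [hs j]
      _ = 2 ^ c * (1 / 2 ^ (blockStart F G (j + 1) + 1)) ^ (s : ℝ) := by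
          rw [Real.rpow_add two_pos, Real.rpow_mul two_pos.le, Real.rpow_neg two_pos.le, one_div,
            ← Real.rpow_natCast]
          push_cast
          rfl
      _ ≤ _ := by gcongr
  have key' : ∀ {y y'}, y ∈ Ico (0 : ℝ) 1 → y' ∈ Ico (0 : ℝ) 1 →
      |y - y'| ≤ 2 ^ c * |spread F G y - spread F G y'| ^ (s : ℝ) := by
    intro y y' hy hy'
    obtain h | rfl | h := lt_trichotomy y y'
    · rw [abs_sub_comm, abs_sub_comm (spread F G y), abs_of_pos (sub_pos.2 h),
        abs_of_pos (key hy hy' h).1]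
      exact (key hy hy' h).2
    · rw [sub_self, abs_zero]
      positivity
    · rw [abs_of_pos (sub_pos.2 h), abs_of_pos (key hy' hy h).1]
      exact (key hy' hy h).2
  have hinj : InjOn (spread F G) (Ico 0 1) := fun y hy y' hy' h => by
    by_contra hne
    obtain h' | h' := lt_or_gt_of_ne hne
    · linarith [(key hy hy' h').1]
    · linarith [(key hy' hy h').1]
  set φ := Function.invFunOn (spread F G) (Ico 0 1)
  have hφ : ∀ y ∈ Ico (0 : ℝ) 1, φ (spread F G y) = y := hinj.leftInvOn_invFunOn
  have hholder : HolderOnWith (Real.toNNReal (2 ^ c)) s φ (spread F G '' Ico 0 1) := by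
    rintro _ ⟨y, hy, rfl⟩ _ ⟨y', hy', rfl⟩
    rw [hφ y hy, hφ y' hy', edist_dist, edist_dist, Real.dist_eq, Real.dist_eq,
      ENNReal.ofReal_rpow_of_nonneg (abs_nonneg _) s.coe_nonneg]
    rw [← ENNReal.ofReal, ← ENNReal.ofReal_mul (by positivity)]
    exact ENNReal.ofReal_le_ofReal (key' hy hy')
  have h1 := hholder.dimH_image_le hs0
  rw [image_image, image_congr hφ, image_id', Real.dimH_of_nonempty_interior (by simp),
    Module.finrank_self, Nat.cast_one, ENNReal.le_div_iff_mul_le (by simp [hs0.ne']) (by simp),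
    one_mul] at h1
  exact h1.trans (dimH_mono (image_subset_range _ _))

end Blocks

/-- The integer part of `c * j ^ 3`. -/
noncomputable def cubicFloor (c : ℝ) (j : ℕ) : ℕ := ⌊c * j ^ 3⌋₊

lemma monotone_cubicFloor {c : ℝ} (hc : 0 ≤ c) : Monotone (cubicFloor c) := fun i j h => by
  unfold cubicFloor
  gcongr

lemma cubicFloor_zero (c : ℝ) : cubicFloor c 0 = 0 := by simp [cubicFloor]

lemma tendsto_cubicFloor {c : ℝ} (hc : 0 < c) : Tendsto (cubicFloor c) atTop atTop :=
  tendsto_nat_floor_atTop.comp <| ((tendsto_pow_atTop three_ne_zero).comp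
    tendsto_natCast_atTop_atTop).const_mul_atTop hc

lemma cubicFloor_le {c : ℝ} (hc : 0 ≤ c) (j : ℕ) : (cubicFloor c j : ℝ) ≤ c * j ^ 3 :=
  Nat.floor_le (by positivity)

lemma lt_cubicFloor_add_one (c : ℝ) (j : ℕ) : c * j ^ 3 < cubicFloor c j + 1 :=
  Nat.lt_floor_add_one _

lemma eventually_cubicFloor_le {d : ℝ} (hd0 : 0 ≤ d) {s : ℝ} (hs : d < s) :
    ∀ᶠ j : ℕ in atTop, (cubicFloor d j + j ^ 2 + 2 * j : ℝ) ≤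
      s * blockStart (cubicFloor d) (cubicFloor (1 - d)) j := by
  filter_upwards [eventually_ge_atTop 2,
    tendsto_natCast_atTop_atTop.eventually_ge_atTop (2 / (s - d))] with j hj hj'
  rw [div_le_iff₀ (sub_pos.2 hs)] at hj'
  have hj : (2 : ℝ) ≤ j := by exact_mod_cast hj
  have h1 := cubicFloor_le hd0 j
  have h2 := lt_cubicFloor_add_one d j
  have h3 := lt_cubicFloor_add_one (1 - d) j
  have h4 : (j : ℝ) ^ 3 ≤ blockStart (cubicFloor d) (cubicFloor (1 - d)) j := by
    simp only [blockStart]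
    push_cast
    nlinarith
  have h5 : s * (j : ℝ) ^ 3 ≤ s * blockStart (cubicFloor d) (cubicFloor (1 - d)) j :=
    mul_le_mul_of_nonneg_left h4 (hd0.trans hs.le)
  nlinarith [mul_le_mul_of_nonneg_right hj' (sq_nonneg (j : ℝ))]

lemma exists_blockStart_succ_le {d : ℝ} (hd0 : 0 ≤ d) (hd1 : d ≤ 1) {s : ℝ} (hs0 : 0 ≤ s)
    (hs : s < d) :
    ∃ c : ℝ, ∀ j : ℕ, s * (blockStart (cubicFloor d) (cubicFloor (1 - d)) (j + 1) + 1 : ℝ) ≤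
      cubicFloor d j + c := by
  set K := 12 / (d - s) with hK
  refine ⟨4 * K ^ 2 + 5 * K + 4, fun j => ?_⟩
  have hK0 : 0 < K := div_pos (by norm_num) (sub_pos.2 hs)
  have hKd : K * (d - s) = 12 := div_mul_cancel₀ _ (sub_pos.2 hs).ne'
  have h1 := cubicFloor_le hd0 (j + 1)
  have h2 := cubicFloor_le (sub_nonneg.2 hd1) (j + 1)
  have h3 := lt_cubicFloor_add_one d j
  have h4 : (blockStart (cubicFloor d) (cubicFloor (1 - d)) (j + 1) + 1 : ℝ) ≤
      j ^ 3 + (4 * j ^ 2 + 5 * j + 3) := by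
    simp only [blockStart]
    push_cast at *
    linarith
  have h5 := mul_le_mul_of_nonneg_left h4 hs0
  have hj : (0 : ℝ) ≤ j := j.cast_nonneg
  have h6 : s * (4 * (j : ℝ) ^ 2 + 5 * j + 3) ≤ 4 * j ^ 2 + 5 * j + 3 :=
    mul_le_of_le_one_left (by positivity) (hs.le.trans hd1)
  have h7 : 4 * (j : ℝ) ^ 2 + 5 * j + 3 ≤ (d - s) * j ^ 3 + (4 * K ^ 2 + 5 * K + 3) := by
    obtain hjK | hjK := le_total (j : ℝ) K
    · have : 0 ≤ (d - s) * (j : ℝ) ^ 3 := mul_nonneg (sub_nonneg.2 hs.le) (by positivity)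
      nlinarith
    · obtain rfl | hj1 := j.eq_zero_or_pos
      · norm_num at hjK
        linarith
      have hj1 : (1 : ℝ) ≤ j := by exact_mod_cast hj1
      have : 12 ≤ (d - s) * (j : ℝ) := by
        rw [← hKd, mul_comm]
        exact mul_le_mul_of_nonneg_left hjK (sub_nonneg.2 hs.le)
      nlinarith [mul_le_mul_of_nonneg_right this (sq_nonneg (j : ℝ))]
  linarith

/-- For every `0 ≤ d ≤ 1` there is a sequence of positive integers tending to `∞`
such that both `E_0(r)` and `E_f(r)` have Hausdorff dimension `d`. -/
theorem exists_seq_dimH_E0_Ef_eq (d : ℝ) (hd0 : 0 ≤ d) (hd1 : d ≤ 1) :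
    ∃ r : ℕ → ℕ, (∀ n, 1 ≤ r n) ∧ Tendsto r atTop atTop ∧
      dimH (E0 r) = ENNReal.ofReal d ∧ dimH (Ef r) = ENNReal.ofReal d := by
  set F := cubicFloor d
  set G := cubicFloor (1 - d)
  have hF : Monotone F := monotone_cubicFloor hd0
  have hG : Monotone G := monotone_cubicFloor (sub_nonneg.2 hd1)
  have := infinite_sigma_fin_succ fun j => G (j + 1) - G j
  obtain ⟨e⟩ : Nonempty (ℕ ≃ Σ j : ℕ, Fin (G (j + 1) - G j + 1)) := nonempty_equiv_of_countable
  set r : ℕ → ℕ := fun n => 2 ^ blockExponent F G (e n) with hr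
  have hEf : ∀ x, (Summable fun p => distNearestInt ((2 ^ blockExponent F G p : ℝ) * x)) →
      x ∈ Ef r := fun x hx => by
    simpa [Ef, hr, Function.comp_def] using e.summable_iff.2 hx
  have hE0 : ∀ x ∈ E0 r,
      Tendsto (fun p => distNearestInt ((2 ^ blockExponent F G p : ℝ) * x)) cofinite (𝓝 0) :=
    fun x hx => by
      have h : Tendsto (fun n => distNearestInt ((r n : ℝ) * x)) cofinite (𝓝 0) := by
        rw [Nat.cofinite_eq_atTop]
        exact hx
      simpa [hr, Function.comp_def] using h.comp e.symm.injective.tendsto_cofinite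
  have hle : dimH (Ef r) ≤ dimH (E0 r) := dimH_mono fun x hx => Summable.tendsto_atTop_zero hx
  have hupper : dimH (E0 r) ≤ ENNReal.ofReal d := by
    have hsub : E0 r ⊆ ⋃ (J : ℕ) (p : ℤ), goodApprox F G J p := fun x hx => by
      obtain ⟨J, hJ⟩ := eventually_distNearestInt_le_of_tendsto (hE0 x hx)
      exact mem_iUnion₂.2 ⟨J, _, rfl, hJ⟩
    refine (dimH_mono hsub).trans ?_
    simp only [dimH_iUnion, iSup_le_iff]
    intro J p
    refine ENNReal.le_of_forall_pos_le_add fun ε hε _ => ?_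
    rw [ENNReal.ofReal, ← ENNReal.coe_add]
    exact dimH_goodApprox_le hF hG J p (eventually_cubicFloor_le hd0 (by
      push_cast
      rw [Real.coe_toNNReal d hd0]
      exact lt_add_of_pos_right d hε))
  have hlower : ENNReal.ofReal d ≤ dimH (Ef r) := by
    have hsub : range (spread F G) ⊆ Ef r := by
      rintro _ ⟨y, rfl⟩
      exact hEf _ (summable_distNearestInt_blockExponent fun j =>
        ⟨spreadInt F G y j, abs_mul_spread_sub_le hF hG y j⟩)
    refine le_trans (ENNReal.le_of_forall_nnreal_lt fun s hs => ?_) (dimH_mono hsub)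
    obtain rfl | hs0 := eq_zero_or_pos s
    · simp
    rw [ENNReal.ofReal, ENNReal.coe_lt_coe, Real.lt_toNNReal_iff_coe_lt] at hs
    obtain ⟨c, hc⟩ := exists_blockStart_succ_le hd0 hd1 s.coe_nonneg hs
    exact le_dimH_range_spread hF hG (cubicFloor_zero d)
      (tendsto_cubicFloor (s.coe_nonneg.trans_lt hs)) hs0 hc
  refine ⟨r, fun n => Nat.one_le_two_pow, ?_, le_antisymm hupper (hlower.trans hle),
    le_antisymm (hle.trans hupper) hlower⟩
  refine (tendsto_pow_atTop_atTop_of_one_lt one_lt_two).comp ?_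
  rw [← Nat.cofinite_eq_atTop]
  exact ((injective_blockExponent hF hG).comp e.injective).tendsto_cofinite
end

section
/- Suppose in addition that a_i + i < b_i for every i ≥ 1. If x ∈ [0,1] has a binary expansion x = Σ_{n=1}^∞ ξ_n 2^{−n} with ξ_n ∈ {0,1} and ξ_n = 0 for every n ∈ ∪_{i=1}^∞ [b_i+1, a_{i+1}+i+1], then for every i ≥ 2 and every integer n with b_{i−1}+1 ≤ n ≤ a_i one has ‖2^n x‖ ≤ 2^{n − a_i − i}; in particular ‖2^n x‖ ≤ 2^{−i} for such n, so 2^n x → 0 modulo 1 as n → ∞ along the set ∪_{i≥2} [b_{i−1}+1, a_i]. -/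
open Filter Set

theorem binary_digit_div_le {ξ : ℕ → ℕ} (hξ : ∀ n, ξ n ≤ 1) (n : ℕ) :
    (ξ (n + 1) : ℝ) / 2 ^ (n + 1) ≤ 1 / 2 / 2 ^ n := by
  have h : (ξ (n + 1) : ℝ) ≤ 1 := by exact_mod_cast hξ (n + 1)
  calc (ξ (n + 1) : ℝ) / 2 ^ (n + 1) ≤ 1 / 2 ^ (n + 1) := by gcongr
    _ = 1 / 2 / 2 ^ n := by rw [pow_succ]; field_simp

theorem summable_binary_digits {ξ : ℕ → ℕ} (hξ : ∀ n, ξ n ≤ 1) :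
    Summable fun n : ℕ => (ξ (n + 1) : ℝ) / 2 ^ (n + 1) := by
  exact .of_nonneg_of_le (fun n => by positivity) (binary_digit_div_le hξ)
    (summable_geometric_two' 1)

theorem tsum_binary_digits_le_one {ξ : ℕ → ℕ} (hξ : ∀ n, ξ n ≤ 1) :
    ∑' n : ℕ, (ξ (n + 1) : ℝ) / 2 ^ (n + 1) ≤ 1 := by
  rw [← tsum_geometric_two' (1 : ℝ)]
  exact (summable_binary_digits hξ).tsum_le_tsum (binary_digit_div_le hξ)
    (summable_geometric_two' 1)

theorem tsum_binary_digits_split {ξ : ℕ → ℕ} (hξ : ∀ n, ξ n ≤ 1) (m : ℕ) :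
    ∑' k : ℕ, (ξ (k + 1) : ℝ) / 2 ^ (k + 1) =
      ∑ k ∈ Finset.range m, (ξ (k + 1) : ℝ) / 2 ^ (k + 1) +
        (∑' k : ℕ, (ξ (k + 1 + m) : ℝ) / 2 ^ (k + 1)) / 2 ^ m := by
  rw [← (summable_binary_digits hξ).sum_add_tsum_nat_add m, ← tsum_div_const]
  congr 2
  funext k
  rw [add_right_comm k m 1, pow_add, div_div]

theorem exists_int_two_pow_mul_sum_binary_digits (ξ : ℕ → ℕ) (n : ℕ) :
    ∃ z : ℤ, (2 : ℝ) ^ n * ∑ k ∈ Finset.range n, (ξ (k + 1) : ℝ) / 2 ^ (k + 1) = z := by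
  refine ⟨∑ k ∈ Finset.range n, (ξ (k + 1) : ℤ) * 2 ^ (n - (k + 1)), ?_⟩
  push_cast
  rw [Finset.mul_sum]
  refine Finset.sum_congr rfl fun k hk => ?_
  rw [pow_sub₀ (2 : ℝ) two_ne_zero (show k + 1 ≤ n from Finset.mem_range.mp hk)]
  ring

/-- If the binary digits of a real number vanish at the positions `n + 1, …, m`, then
multiplication by `2 ^ n` brings it within `2 ^ n / 2 ^ m` of an integer. -/
theorem distNearestInt_two_pow_mul_le {ξ : ℕ → ℕ} (hξ : ∀ n, ξ n ≤ 1) {n m : ℕ} (hnm : n ≤ m)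
    (h0 : ∀ k, n < k → k ≤ m → ξ k = 0) :
    distNearestInt ((2 : ℝ) ^ n * ∑' k : ℕ, (ξ (k + 1) : ℝ) / 2 ^ (k + 1)) ≤ 2 ^ n / 2 ^ m := by
  obtain ⟨z, hz⟩ := exists_int_two_pow_mul_sum_binary_digits ξ n
  have hhead : ∑ k ∈ Finset.range m, (ξ (k + 1) : ℝ) / 2 ^ (k + 1) =
      ∑ k ∈ Finset.range n, (ξ (k + 1) : ℝ) / 2 ^ (k + 1) := by
    refine (Finset.sum_subset (Finset.range_mono hnm) fun k hk hkn => ?_).symm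
    rw [Finset.mem_range] at hk hkn
    simp [h0 (k + 1) (by lia) hk]
  have htail : ∑' k : ℕ, (ξ (k + 1 + m) : ℝ) / 2 ^ (k + 1) ≤ 1 :=
    tsum_binary_digits_le_one (ξ := fun k => ξ (k + m)) fun k => hξ (k + m)
  have htail0 : 0 ≤ ∑' k : ℕ, (ξ (k + 1 + m) : ℝ) / 2 ^ (k + 1) :=
    tsum_nonneg fun k => by positivity
  refine (round_le _ z).trans ?_
  rw [tsum_binary_digits_split hξ m, hhead, mul_add, hz, add_sub_cancel_left,
    abs_of_nonneg (by positivity), mul_div_assoc']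
  gcongr
  exact mul_le_of_le_one_right (by positivity) htail

/-- If `a_i + i < b_i` for all `i ≥ 1` and `x ∈ [0,1]` has a binary expansion whose
digits vanish on `⋃_{i ≥ 1} [b_i + 1, a_{i+1} + i + 1]`, then for every `i ≥ 2` and
every `n` with `b_{i-1} + 1 ≤ n ≤ a_i` one has `‖2^n x‖ ≤ 2^{n - a_i - i}`, in
particular `‖2^n x‖ ≤ 2^{-i}`; consequently `2^n x → 0 (mod 1)` as `n → ∞` along
`⋃_{i ≥ 2} [b_{i-1} + 1, a_i]`. -/
theorem distNearestInt_le_and_tendsto_zero (a b : ℕ → ℕ)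
    (ha1 : a 1 = 0) (hab1 : a 1 ≤ b 1)
    (hba : ∀ i, 1 ≤ i → b i < a (i + 1))
    (hab : ∀ i, 1 ≤ i → a (i + 1) < b (i + 1))
    (hib : ∀ i, 1 ≤ i → a i + i < b i)
    (x : ℝ) (hx : x ∈ Set.Icc (0 : ℝ) 1) (ξ : ℕ → ℕ) (hξ : ∀ n, ξ n ≤ 1)
    (h0 : ∀ i, 1 ≤ i → ∀ n, b i + 1 ≤ n → n ≤ a (i + 1) + i + 1 → ξ n = 0)
    (hexp : x = ∑' n : ℕ, (ξ (n + 1) : ℝ) / 2 ^ (n + 1)) :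
    (∀ i, 2 ≤ i → ∀ n, b (i - 1) + 1 ≤ n → n ≤ a i →
      distNearestInt ((2 : ℝ) ^ n * x) ≤ (2 : ℝ) ^ ((n : ℤ) - (a i : ℤ) - (i : ℤ)) ∧
      distNearestInt ((2 : ℝ) ^ n * x) ≤ (2 : ℝ) ^ (-(i : ℤ))) ∧
    (∀ ε > (0 : ℝ), ∃ N : ℕ, ∀ n, N ≤ n →
      (∃ i, 2 ≤ i ∧ b (i - 1) + 1 ≤ n ∧ n ≤ a i) →
      distNearestInt ((2 : ℝ) ^ n * x) < ε) := by
  have hmain : ∀ i, 2 ≤ i → ∀ n, b (i - 1) + 1 ≤ n → n ≤ a i →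
      distNearestInt ((2 : ℝ) ^ n * x) ≤ (2 : ℝ) ^ ((n : ℤ) - (a i : ℤ) - (i : ℤ)) := by
    intro i hi n hbn hna
    obtain ⟨j, rfl⟩ : ∃ j, i = j + 1 := ⟨i - 1, by lia⟩
    have h := distNearestInt_two_pow_mul_le hξ (n := n) (m := a (j + 1) + (j + 1)) (by lia)
      fun k hnk hkm => h0 j (by lia) k (by rw [Nat.add_sub_cancel] at hbn; lia) (by lia)
    rw [← hexp] at h
    rwa [sub_sub, zpow_sub₀ two_ne_zero, ← Nat.cast_add, zpow_natCast, zpow_natCast]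
  have hcor : ∀ i, 2 ≤ i → ∀ n, b (i - 1) + 1 ≤ n → n ≤ a i →
      distNearestInt ((2 : ℝ) ^ n * x) ≤ (2 : ℝ) ^ (-(i : ℤ)) := fun i hi n hbn hna =>
    (hmain i hi n hbn hna).trans (zpow_le_zpow_right₀ one_le_two (by lia))
  refine ⟨fun i hi n hbn hna => ⟨hmain i hi n hbn hna, hcor i hi n hbn hna⟩, fun ε hε => ?_⟩
  obtain ⟨I, hI⟩ := exists_pow_lt_of_lt_one hε (one_half_lt_one (α := ℝ))
  refine ⟨∑ i ∈ Finset.range I, a i + 1, ?_⟩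
  rintro n hn ⟨i, hi, hbn, hna⟩
  have hIi : I ≤ i := by
    by_contra! hlt
    have := Finset.single_le_sum (f := a) (fun _ _ => Nat.zero_le _) (Finset.mem_range.mpr hlt)
    lia
  calc distNearestInt ((2 : ℝ) ^ n * x) ≤ (2 : ℝ) ^ (-(i : ℤ)) := hcor i hi n hbn hna
    _ ≤ (2 : ℝ) ^ (-(I : ℤ)) := zpow_le_zpow_right₀ one_le_two (by lia)
    _ = (1 / 2) ^ I := by rw [zpow_neg, zpow_natCast, one_div, inv_pow]
    _ < ε := hI
end

section
/- Let x ∈ [0,1] have a binary expansion x = Σ_{n=1}^∞ ξ_n 2^{−n} with ξ_n ∈ {0,1}. If ‖2^n x‖ → 0 as n → ∞ along the set ∪_{i=1}^∞ [b_i+1, a_{i+1}], then there exists j ≥ 1 such that for every i ≥ j the digits ξ_{b_i+2}, ξ_{b_i+3}, …, ξ_{a_{i+1}+2} are all equal. -/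
open Filter Set

/-- The number in `[0, 1]` whose binary digits are `ξ (m + 1), ξ (m + 2), …`. -/
noncomputable def binaryTail (ξ : ℕ → ℕ) (m : ℕ) : ℝ :=
  ∑' k : ℕ, (ξ (m + k + 1) : ℝ) / 2 ^ (k + 1)

lemma hasSum_one_div_two_pow_succ : HasSum (fun k : ℕ => (1 : ℝ) / 2 ^ (k + 1)) 1 := by
  convert hasSum_geometric_two' (1 : ℝ) using 2 with k
  rw [pow_succ']
  field_simp

lemma digit_div_le {ξ : ℕ → ℕ} (hξ : ∀ n, ξ n ≤ 1) (m k : ℕ) :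
    (ξ (m + k + 1) : ℝ) / 2 ^ (k + 1) ≤ 1 / 2 ^ (k + 1) := by
  gcongr
  exact_mod_cast hξ _

lemma summable_binaryTail {ξ : ℕ → ℕ} (hξ : ∀ n, ξ n ≤ 1) (m : ℕ) :
    Summable fun k : ℕ => (ξ (m + k + 1) : ℝ) / 2 ^ (k + 1) :=
  Summable.of_nonneg_of_le (fun _ => by positivity) (digit_div_le hξ m)
    hasSum_one_div_two_pow_succ.summable

lemma binaryTail_nonneg (ξ : ℕ → ℕ) (m : ℕ) : 0 ≤ binaryTail ξ m :=
  tsum_nonneg fun _ => by positivity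

lemma binaryTail_le_one {ξ : ℕ → ℕ} (hξ : ∀ n, ξ n ≤ 1) (m : ℕ) : binaryTail ξ m ≤ 1 :=
  hasSum_le (digit_div_le hξ m) (summable_binaryTail hξ m).hasSum hasSum_one_div_two_pow_succ

lemma two_mul_binaryTail {ξ : ℕ → ℕ} (hξ : ∀ n, ξ n ≤ 1) (m : ℕ) :
    2 * binaryTail ξ m = ξ (m + 1) + binaryTail ξ (m + 1) := by
  unfold binaryTail
  rw [(summable_binaryTail hξ m).tsum_eq_zero_add, mul_add, ← tsum_mul_left]
  congr 1
  · simp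
    ring
  · refine tsum_congr fun k => ?_
    rw [show m + (k + 1) + 1 = m + 1 + k + 1 by ring, pow_succ' (2 : ℝ) (k + 1)]
    field_simp

lemma exists_two_pow_mul_eq_add_binaryTail {ξ : ℕ → ℕ} (hξ : ∀ n, ξ n ≤ 1) (n : ℕ) :
    ∃ z : ℤ, (2 : ℝ) ^ n * binaryTail ξ 0 = z + binaryTail ξ n := by
  induction n with
  | zero => exact ⟨0, by simp⟩
  | succ n ih =>
    obtain ⟨z, hz⟩ := ih
    refine ⟨2 * z + ξ (n + 1), ?_⟩
    push_cast
    rw [pow_succ']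
    linarith [two_mul_binaryTail hξ n]

lemma quarter_le_distNearestInt_int_add {t : ℝ} (h₁ : 1 / 4 ≤ t) (h₂ : t ≤ 3 / 4) (z : ℤ) :
    1 / 4 ≤ distNearestInt (z + t) := by
  unfold distNearestInt
  rw [round_intCast_add]
  push_cast
  rw [add_sub_add_left_eq_sub]
  rcases le_or_gt (round t) 0 with h | h
  · have h' : (round t : ℝ) ≤ 0 := by exact_mod_cast h
    exact le_trans (by linarith) (le_abs_self _)
  · have h' : (1 : ℝ) ≤ round t := by exact_mod_cast h
    exact le_trans (by linarith) (neg_le_abs _)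

lemma digit_eq_of_distNearestInt_lt {ξ : ℕ → ℕ} (hξ : ∀ n, ξ n ≤ 1) {n : ℕ}
    (h : distNearestInt ((2 : ℝ) ^ n * binaryTail ξ 0) < 1 / 4) : ξ (n + 2) = ξ (n + 1) := by
  by_contra hne
  obtain ⟨z, hz⟩ := exists_two_pow_mul_eq_add_binaryTail hξ n
  rw [hz] at h
  have e₁ := two_mul_binaryTail hξ n
  have e₂ := two_mul_binaryTail hξ (n + 1)
  have l := binaryTail_nonneg ξ (n + 2)
  have u := binaryTail_le_one hξ (n + 2)
  have hcases : ξ (n + 1) = 0 ∧ ξ (n + 2) = 1 ∨ ξ (n + 1) = 1 ∧ ξ (n + 2) = 0 := by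
    have := hξ (n + 1)
    have := hξ (n + 2)
    omega
  refine h.not_ge (quarter_le_distNearestInt_int_add ?_ ?_ z) <;>
    rcases hcases with ⟨h₁, h₂⟩ | ⟨h₁, h₂⟩ <;>
    · simp only [add_assoc, Nat.reduceAdd, h₁, h₂, Nat.cast_zero, Nat.cast_one] at e₁ e₂
      linarith

/-- If `x ∈ [0,1]` has a binary expansion `x = ∑ ξ_n 2^{-n}` and `‖2^n x‖ → 0` as
`n → ∞` along `⋃_{i ≥ 1} [b_i + 1, a_{i+1}]`, then there is `j ≥ 1` such that for
every `i ≥ j` the digits `ξ_{b_i+2}, …, ξ_{a_{i+1}+2}` are all equal. -/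
theorem eventually_digits_eq_of_tendsto_zero (a b : ℕ → ℕ)
    (ha1 : a 1 = 0) (hab1 : a 1 ≤ b 1)
    (hba : ∀ i, 1 ≤ i → b i < a (i + 1))
    (hab : ∀ i, 1 ≤ i → a (i + 1) < b (i + 1))
    (x : ℝ) (hx : x ∈ Set.Icc (0 : ℝ) 1) (ξ : ℕ → ℕ) (hξ : ∀ n, ξ n ≤ 1)
    (hexp : x = ∑' n : ℕ, (ξ (n + 1) : ℝ) / 2 ^ (n + 1))
    (htend : ∀ ε > (0 : ℝ), ∃ N : ℕ, ∀ n, N ≤ n →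
      (∃ i, 1 ≤ i ∧ b i + 1 ≤ n ∧ n ≤ a (i + 1)) →
      distNearestInt ((2 : ℝ) ^ n * x) < ε) :
    ∃ j, 1 ≤ j ∧ ∀ i, j ≤ i → ∀ n, b i + 2 ≤ n → n ≤ a (i + 1) + 2 →
      ξ n = ξ (b i + 2) := by
  have hx0 : x = binaryTail ξ 0 := by simpa [binaryTail] using hexp
  obtain ⟨N, hN⟩ := htend (1 / 4) (by norm_num)
  have hb : ∀ i, i ≤ b (i + 1) := by
    intro i
    induction i with
    | zero => exact Nat.zero_le _
    | succ i ih =>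
      have := hba (i + 1) (by omega)
      have := hab (i + 1) (by omega)
      omega
  refine ⟨N + 1, by omega, fun i hi n hn => ?_⟩
  induction n, hn using Nat.le_induction with
  | base => exact fun _ => rfl
  | succ n hn ih =>
    intro hna
    rw [← ih (by omega)]
    obtain ⟨k, rfl⟩ : ∃ k, n = k + 1 := ⟨n - 1, by omega⟩
    obtain ⟨i', rfl⟩ : ∃ i', i = i' + 1 := ⟨i - 1, by omega⟩
    have := hb i'
    refine digit_eq_of_distNearestInt_lt hξ ?_
    rw [← hx0]
    exact hN k (by omega) ⟨i' + 1, by omega, by omega, by omega⟩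
end
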